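/- The LQ mean field social optimization problem has asymptotic solvability if and only if the limiting ODE system (ODE-Λ) has a solution (Λ₁, Λ₂) on [0, T]. -/

import Mathlib

open Matrix Set

namespace LQ

/-- Frobenius norm of a real matrix. -/
noncomputable def frob {a b : Type*} [Fintype a] [Fintype b] (M : Matrix a b ℝ) : ℝ :=
  Real.sqrt (∑ i, ∑ j, (M i j) ^ 2)

/-- Entrywise ℓ₁ norm of a real matrix. -/
noncomputable def l1norm {a b : Type*} [Fintype a] [Fintype b] (M : Matrix a b ℝ) : ℝ :=
  ∑ i, ∑ j, |M i j|

/-- Block matrix with all diagonal m×m blocks equal to `F` and all off-diagonal blocks equal to `K`. -/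
def blockConst (N m : ℕ) (F K : Matrix (Fin m) (Fin m) ℝ) :
    Matrix (Fin N × Fin m) (Fin N × Fin m) ℝ :=
  Matrix.of fun x y => if x.1 = y.1 then F x.2 y.2 else K x.2 y.2

/-- Block matrix with diagonal blocks `Λ₁` and off-diagonal blocks `Λ₂ / N`. -/
noncomputable def blockPN (N n : ℕ) (Λ₁ Λ₂ : Matrix (Fin n) (Fin n) ℝ) :
    Matrix (Fin N × Fin n) (Fin N × Fin n) ℝ :=
  Matrix.of fun x y => if x.1 = y.1 then Λ₁ x.2 y.2 else Λ₂ x.2 y.2 / (N : ℝ)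

/-- The permutation matrix exchanging the i-th and j-th block rows of `I_{Nn}`. -/
def Jswap (N n : ℕ) (i j : Fin N) : Matrix (Fin N × Fin n) (Fin N × Fin n) ℝ :=
  Matrix.of fun x y => if y.1 = Equiv.swap i j x.1 ∧ y.2 = x.2 then 1 else 0

/-- `I_N ⊗ M`. -/
def kronIN (N : ℕ) {a b : ℕ} (M : Matrix (Fin a) (Fin b) ℝ) :
    Matrix (Fin N × Fin a) (Fin N × Fin b) ℝ :=
  Matrix.of fun x y => if x.1 = y.1 then M x.2 y.2 else 0

/-- `𝟏_{N×1} ⊗ M`. -/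
def stackN (N : ℕ) {a b : ℕ} (M : Matrix (Fin a) (Fin b) ℝ) :
    Matrix (Fin N × Fin a) (Fin b) ℝ :=
  Matrix.of fun x y => M x.2 y

/-- Data of the LQ mean field social optimization problem. -/
structure Params (n n₁ : ℕ) where
  A : Matrix (Fin n) (Fin n) ℝ
  G : Matrix (Fin n) (Fin n) ℝ
  Γ : Matrix (Fin n) (Fin n) ℝ
  Γf : Matrix (Fin n) (Fin n) ℝ
  B : Matrix (Fin n) (Fin n₁) ℝ
  B0 : Matrix (Fin n) (Fin n₁) ℝ
  B1 : Matrix (Fin n) (Fin n₁) ℝ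
  D : Matrix (Fin n) (Fin 1) ℝ
  D0 : Matrix (Fin n) (Fin 1) ℝ
  Q : Matrix (Fin n) (Fin n) ℝ
  Qf : Matrix (Fin n) (Fin n) ℝ
  R : Matrix (Fin n₁) (Fin n₁) ℝ
  T : ℝ

namespace Params

variable {n n₁ : ℕ} (p : Params n n₁)

/-- Standing hypotheses: positive dimensions, positive horizon, symmetric weights. -/
def Standing : Prop :=
  1 ≤ n ∧ 1 ≤ n₁ ∧ 0 < p.T ∧ p.Q.IsSymm ∧ p.Qf.IsSymm ∧ p.R.IsSymm

/-- Q^Γ = Γᵀ Q Γ − Q Γ − Γᵀ Q. -/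
def QΓ : Matrix (Fin n) (Fin n) ℝ := p.Γᵀ * p.Q * p.Γ - p.Q * p.Γ - p.Γᵀ * p.Q

/-- Q_f^Γ = Γ_fᵀ Q_f Γ_f − Q_f Γ_f − Γ_fᵀ Q_f. -/
def QfΓ : Matrix (Fin n) (Fin n) ℝ := p.Γfᵀ * p.Qf * p.Γf - p.Qf * p.Γf - p.Γfᵀ * p.Qf

/-- ℛ₁(Λ₁) = R + B₁ᵀ Λ₁ B₁. -/
def R1 (Λ₁ : Matrix (Fin n) (Fin n) ℝ) : Matrix (Fin n₁) (Fin n₁) ℝ :=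
  p.R + p.B1ᵀ * Λ₁ * p.B1

/-- ℛ₂(Λ₁,Λ₂) = R + B₁ᵀ Λ₁ B₁ + B₀ᵀ(Λ₁+Λ₂)B₀. -/
def R2 (Λ₁ Λ₂ : Matrix (Fin n) (Fin n) ℝ) : Matrix (Fin n₁) (Fin n₁) ℝ :=
  p.R + p.B1ᵀ * Λ₁ * p.B1 + p.B0ᵀ * (Λ₁ + Λ₂) * p.B0

/-- Ψ₁. -/
noncomputable def Ψ₁ (Λ₁ : Matrix (Fin n) (Fin n) ℝ) : Matrix (Fin n) (Fin n) ℝ :=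
  Λ₁ * p.B * (p.R1 Λ₁)⁻¹ * p.Bᵀ * Λ₁ - Λ₁ * p.A - p.Aᵀ * Λ₁ - p.Q

/-- Ψ₂. -/
noncomputable def Ψ₂ (Λ₁ Λ₂ : Matrix (Fin n) (Fin n) ℝ) : Matrix (Fin n) (Fin n) ℝ :=
  (Λ₁ + Λ₂) * p.B * (p.R2 Λ₁ Λ₂)⁻¹ * p.Bᵀ * (Λ₁ + Λ₂)
    - Λ₁ * p.B * (p.R1 Λ₁)⁻¹ * p.Bᵀ * Λ₁
    - (Λ₁ * p.G + Λ₂ * (p.A + p.G))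
    - (p.Gᵀ * Λ₁ + (p.Aᵀ + p.Gᵀ) * Λ₂)
    - p.QΓ

/-- Solution of the limiting ODE system (ODE-Λ) on [0,T]. -/
noncomputable def IsSolLim (Λ₁ Λ₂ : ℝ → Matrix (Fin n) (Fin n) ℝ) : Prop :=
  (∀ t ∈ Icc (0 : ℝ) p.T, (Λ₁ t).IsSymm ∧ (Λ₂ t).IsSymm) ∧
  (∀ t ∈ Icc (0 : ℝ) p.T, (p.R1 (Λ₁ t)).PosDef ∧ (p.R2 (Λ₁ t) (Λ₂ t)).PosDef) ∧
  Λ₁ p.T = p.Qf ∧ Λ₂ p.T = p.QfΓ ∧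
  (∀ t ∈ Icc (0 : ℝ) p.T, ∀ i j, HasDerivWithinAt (fun s => Λ₁ s i j)
    (p.Ψ₁ (Λ₁ t) i j) (Icc (0 : ℝ) p.T) t) ∧
  (∀ t ∈ Icc (0 : ℝ) p.T, ∀ i j, HasDerivWithinAt (fun s => Λ₂ s i j)
    (p.Ψ₂ (Λ₁ t) (Λ₂ t) i j) (Icc (0 : ℝ) p.T) t)

/-! Big (N-agent) matrices. -/

noncomputable def bigA (N : ℕ) : Matrix (Fin N × Fin n) (Fin N × Fin n) ℝ :=
  Matrix.of fun x y => (if x.1 = y.1 then p.A x.2 y.2 else 0) + p.G x.2 y.2 / (N : ℝ)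

def bigBhat (N : ℕ) : Matrix (Fin N × Fin n) (Fin N × Fin n₁) ℝ :=
  Matrix.of fun x y => if x.1 = y.1 then p.B x.2 y.2 else 0

def bigB (N : ℕ) (i : Fin N) : Matrix (Fin N × Fin n) (Fin n₁) ℝ :=
  Matrix.of fun x l => if x.1 = i then p.B1 x.2 l else 0

noncomputable def bigB0 (N : ℕ) : Matrix (Fin N × Fin n) (Fin n₁) ℝ :=
  Matrix.of fun x l => p.B0 x.2 l / (N : ℝ)

def bigD (N : ℕ) (i : Fin N) : Matrix (Fin N × Fin n) (Fin 1) ℝ :=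
  Matrix.of fun x l => if x.1 = i then p.D x.2 l else 0

def bigD0 (N : ℕ) : Matrix (Fin N × Fin n) (Fin 1) ℝ :=
  Matrix.of fun x l => p.D0 x.2 l

def bigE (_p : Params n n₁) (N : ℕ) (i : Fin N) : Matrix (Fin n₁) (Fin N × Fin n₁) ℝ :=
  Matrix.of fun k y => if y.1 = i ∧ y.2 = k then 1 else 0

def bigIhat (_p : Params n n₁) (N : ℕ) : Matrix (Fin n₁) (Fin N × Fin n₁) ℝ :=
  Matrix.of fun k y => if y.2 = k then 1 else 0

noncomputable def bigQ (N : ℕ) : Matrix (Fin N × Fin n) (Fin N × Fin n) ℝ :=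
  Matrix.of fun x y => (if x.1 = y.1 then p.Q x.2 y.2 else 0) + p.QΓ x.2 y.2 / (N : ℝ)

noncomputable def bigQf (N : ℕ) : Matrix (Fin N × Fin n) (Fin N × Fin n) ℝ :=
  Matrix.of fun x y => (if x.1 = y.1 then p.Qf x.2 y.2 else 0) + p.QfΓ x.2 y.2 / (N : ℝ)

def bigR (N : ℕ) : Matrix (Fin N × Fin n₁) (Fin N × Fin n₁) ℝ :=
  Matrix.of fun x y => if x.1 = y.1 then p.R x.2 y.2 else 0

/-- 𝓜₀. -/
noncomputable def M0 (N : ℕ) (Z : Matrix (Fin N × Fin n) (Fin N × Fin n) ℝ) :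
    Matrix (Fin 1) (Fin 1) ℝ :=
  (1 / 2 : ℝ) • (∑ i : Fin N, (p.bigD N i)ᵀ * Z * p.bigD N i)
    + (1 / 2 : ℝ) • ((p.bigD0 N)ᵀ * Z * p.bigD0 N)

/-- 𝓜₁. -/
noncomputable def M1 (N : ℕ) (Z : Matrix (Fin N × Fin n) (Fin N × Fin n) ℝ) :
    Matrix (Fin 1) (Fin N × Fin n₁) ℝ :=
  (∑ i : Fin N, (p.bigD N i)ᵀ * Z * p.bigB N i * p.bigE N i)
    + (p.bigD0 N)ᵀ * Z * p.bigB0 N * p.bigIhat N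

/-- 𝓜₂. -/
noncomputable def M2 (N : ℕ) (Z : Matrix (Fin N × Fin n) (Fin N × Fin n) ℝ) :
    Matrix (Fin N × Fin n₁) (Fin N × Fin n₁) ℝ :=
  (1 / 2 : ℝ) • (∑ i : Fin N, (p.bigE N i)ᵀ * (p.bigB N i)ᵀ * Z * p.bigB N i * p.bigE N i)
    + (1 / 2 : ℝ) • ((p.bigIhat N)ᵀ * (p.bigB0 N)ᵀ * Z * p.bigB0 N * p.bigIhat N)

/-- Right-hand side of the Riccati equation (ODE-P). -/
noncomputable def PRic (N : ℕ) (P : Matrix (Fin N × Fin n) (Fin N × Fin n) ℝ) :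
    Matrix (Fin N × Fin n) (Fin N × Fin n) ℝ :=
  P * p.bigBhat N * (p.bigR N + (2 : ℝ) • p.M2 N P)⁻¹ * (p.bigBhat N)ᵀ * P
    - P * p.bigA N - (p.bigA N)ᵀ * P - p.bigQ N

/-- Solution of the large-scale Riccati equation (ODE-P) on [0,T]. -/
noncomputable def IsSolP (N : ℕ) (P : ℝ → Matrix (Fin N × Fin n) (Fin N × Fin n) ℝ) : Prop :=
  (∀ t ∈ Icc (0 : ℝ) p.T, (P t).IsSymm) ∧
  (∀ t ∈ Icc (0 : ℝ) p.T, (p.bigR N + (2 : ℝ) • p.M2 N (P t)).PosDef) ∧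
  P p.T = p.bigQf N ∧
  (∀ t ∈ Icc (0 : ℝ) p.T, ∀ x y, HasDerivWithinAt (fun s => P s x y)
    (p.PRic N (P t) x y) (Icc (0 : ℝ) p.T) t)

/-- Solution of the companion linear equation (ODE-S) on [0,T], relative to `P`. -/
noncomputable def IsSolS (N : ℕ) (P : ℝ → Matrix (Fin N × Fin n) (Fin N × Fin n) ℝ)
    (S : ℝ → Matrix (Fin N × Fin n) (Fin 1) ℝ) : Prop :=
  S p.T = 0 ∧
  (∀ t ∈ Icc (0 : ℝ) p.T, ∀ x y, HasDerivWithinAt (fun s => S s x y)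
    ((P t * p.bigBhat N * (p.bigR N + (2 : ℝ) • p.M2 N (P t))⁻¹ *
        ((p.bigBhat N)ᵀ * S t + (p.M1 N (P t))ᵀ) - (p.bigA N)ᵀ * S t) x y)
    (Icc (0 : ℝ) p.T) t)

/-- Solution of the companion scalar equation (ODE-r) on [0,T], relative to `P` and `S`. -/
noncomputable def IsSolr (N : ℕ) (P : ℝ → Matrix (Fin N × Fin n) (Fin N × Fin n) ℝ)
    (S : ℝ → Matrix (Fin N × Fin n) (Fin 1) ℝ) (r : ℝ → ℝ) : Prop :=
  r p.T = 0 ∧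
  (∀ t ∈ Icc (0 : ℝ) p.T, HasDerivWithinAt r
    (((((S t)ᵀ * p.bigBhat N + p.M1 N (P t)) * (p.bigR N + (2 : ℝ) • p.M2 N (P t))⁻¹ *
        ((p.bigBhat N)ᵀ * S t + (p.M1 N (P t))ᵀ)) - (2 : ℝ) • p.M0 N (P t)) 0 0)
    (Icc (0 : ℝ) p.T) t)

/-- Asymptotic solvability of the LQ mean field social optimization problem. -/
noncomputable def AsympSolvable : Prop :=
  ∃ N₀ : ℕ, 1 ≤ N₀ ∧ ∃ c₀ : ℝ, 0 < c₀ ∧ ∃ C : ℝ,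
    ∀ N : ℕ, N₀ ≤ N →
      ∃ P : ℝ → Matrix (Fin N × Fin n) (Fin N × Fin n) ℝ,
        p.IsSolP N P ∧
        (∀ t ∈ Icc (0 : ℝ) p.T, l1norm (P t) / (N : ℝ) ≤ C) ∧
        (∀ t ∈ Icc (0 : ℝ) p.T,
          (p.bigR N + (2 : ℝ) • p.M2 N (P t) - c₀ • 1).PosSemidef)

/-! The rescaled low-dimensional system. -/

/-- E^N. -/
noncomputable def EN (N : ℕ) (Λ₁ Λ₂ : Matrix (Fin n) (Fin n) ℝ) :
    Matrix (Fin n₁) (Fin n₁) ℝ :=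
  (1 / (N : ℝ)) •
    ((p.R2 Λ₁ Λ₂ - (1 / (N : ℝ)) • (p.B0ᵀ * Λ₂ * p.B0))⁻¹ - (p.R1 Λ₁)⁻¹)

/-- H^N. -/
noncomputable def HN (N : ℕ) (Λ₁ Λ₂ : Matrix (Fin n) (Fin n) ℝ) :
    Matrix (Fin n₁) (Fin n₁) ℝ :=
  p.EN N Λ₁ Λ₂ + (p.R1 Λ₁)⁻¹

/-- g₁. -/
noncomputable def g₁ (N : ℕ) (Λ₁ Λ₂ : Matrix (Fin n) (Fin n) ℝ) :
    Matrix (Fin n) (Fin n) ℝ :=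
  Λ₁ * p.B * p.EN N Λ₁ Λ₂ * p.Bᵀ * Λ₁
  + (1 - 1 / (N : ℝ)) •
      (Λ₂ * p.B * p.EN N Λ₁ Λ₂ * p.Bᵀ * Λ₁ + Λ₁ * p.B * p.EN N Λ₁ Λ₂ * p.Bᵀ * Λ₂)
  + (1 / (N : ℝ) - 1 / (N : ℝ) ^ 2) •
      (Λ₂ * p.B * (p.HN N Λ₁ Λ₂ + ((N : ℝ) - 2) • p.EN N Λ₁ Λ₂) * p.Bᵀ * Λ₂)
  - (1 / (N : ℝ)) •
      ((Λ₁ * p.G + p.Gᵀ * Λ₁) + (1 - 1 / (N : ℝ)) • (Λ₂ * p.G + p.Gᵀ * Λ₂))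
  - (1 / (N : ℝ)) • p.QΓ

/-- g₂. -/
noncomputable def g₂ (N : ℕ) (Λ₁ Λ₂ : Matrix (Fin n) (Fin n) ℝ) :
    Matrix (Fin n) (Fin n) ℝ :=
  (Λ₁ + Λ₂) * p.B *
      ((N : ℝ) • p.EN N Λ₁ Λ₂ + (p.R1 Λ₁)⁻¹ - (p.R2 Λ₁ Λ₂)⁻¹) * p.Bᵀ * (Λ₁ + Λ₂)
  - (2 / (N : ℝ)) • (Λ₂ * p.B * (p.R1 Λ₁)⁻¹ * p.Bᵀ * Λ₂)
  + (1 / (N : ℝ) - 2) • (Λ₂ * p.B * p.EN N Λ₁ Λ₂ * p.Bᵀ * Λ₂)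
  - Λ₁ * p.B * p.EN N Λ₁ Λ₂ * p.Bᵀ * Λ₂
  - Λ₂ * p.B * p.EN N Λ₁ Λ₂ * p.Bᵀ * Λ₁
  + (1 / (N : ℝ)) • (Λ₂ * p.G + p.Gᵀ * Λ₂)

/-- Solution of the rescaled system (ODE-Λ^N) on [0,T]. -/
noncomputable def IsSolLamN (N : ℕ) (Λ₁ Λ₂ : ℝ → Matrix (Fin n) (Fin n) ℝ) : Prop :=
  (∀ t ∈ Icc (0 : ℝ) p.T, (Λ₁ t).IsSymm ∧ (Λ₂ t).IsSymm) ∧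
  (∀ t ∈ Icc (0 : ℝ) p.T, (p.R1 (Λ₁ t)).PosDef ∧ (p.R2 (Λ₁ t) (Λ₂ t)).PosDef ∧
    (p.R2 (Λ₁ t) (Λ₂ t) - (1 / (N : ℝ)) • (p.B0ᵀ * Λ₂ t * p.B0)).PosDef) ∧
  Λ₁ p.T = p.Qf + (1 / (N : ℝ)) • p.QfΓ ∧ Λ₂ p.T = p.QfΓ ∧
  (∀ t ∈ Icc (0 : ℝ) p.T, ∀ i j, HasDerivWithinAt (fun s => Λ₁ s i j)
    ((p.Ψ₁ (Λ₁ t) + p.g₁ N (Λ₁ t) (Λ₂ t)) i j) (Icc (0 : ℝ) p.T) t) ∧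
  (∀ t ∈ Icc (0 : ℝ) p.T, ∀ i j, HasDerivWithinAt (fun s => Λ₂ s i j)
    ((p.Ψ₂ (Λ₁ t) (Λ₂ t) + p.g₂ N (Λ₁ t) (Λ₂ t)) i j) (Icc (0 : ℝ) p.T) t)

/-! Companion (mean-field) equations. -/

/-- φ₁. -/
noncomputable def φ₁ (Λ₁ Λ₂ : Matrix (Fin n) (Fin n) ℝ) (S : Matrix (Fin n) (Fin 1) ℝ) :
    Matrix (Fin n) (Fin 1) ℝ :=
  (Λ₁ + Λ₂) * p.B * (p.R2 Λ₁ Λ₂)⁻¹ *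
      (p.Bᵀ * S + p.B1ᵀ * Λ₁ * p.D + p.B0ᵀ * (Λ₁ + Λ₂) * p.D0)
    - (p.A + p.G)ᵀ * S

/-- φ₂. -/
noncomputable def φ₂ (Λ₁ Λ₂ : Matrix (Fin n) (Fin n) ℝ) (S : Matrix (Fin n) (Fin 1) ℝ) :
    Matrix (Fin 1) (Fin 1) ℝ :=
  (Sᵀ * p.B + p.Dᵀ * Λ₁ * p.B1 + p.D0ᵀ * (Λ₁ + Λ₂) * p.B0) * (p.R2 Λ₁ Λ₂)⁻¹ *
      (p.Bᵀ * S + p.B1ᵀ * Λ₁ * p.D + p.B0ᵀ * (Λ₁ + Λ₂) * p.D0)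
    - p.Dᵀ * Λ₁ * p.D - p.D0ᵀ * (Λ₁ + Λ₂) * p.D0

/-- Solution of the limiting companion system (ODE-Sr) on [0,T]. -/
noncomputable def IsSolSr (Λ₁ Λ₂ : ℝ → Matrix (Fin n) (Fin n) ℝ)
    (S : ℝ → Matrix (Fin n) (Fin 1) ℝ) (r : ℝ → ℝ) : Prop :=
  S p.T = 0 ∧ r p.T = 0 ∧
  (∀ t ∈ Icc (0 : ℝ) p.T, ∀ i j, HasDerivWithinAt (fun s => S s i j)
    (p.φ₁ (Λ₁ t) (Λ₂ t) (S t) i j) (Icc (0 : ℝ) p.T) t) ∧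
  (∀ t ∈ Icc (0 : ℝ) p.T, HasDerivWithinAt r
    ((p.φ₂ (Λ₁ t) (Λ₂ t) (S t)) 0 0) (Icc (0 : ℝ) p.T) t)

/-- g₀₁. -/
noncomputable def g01 (N : ℕ) (Λ₁ Λ₂ : Matrix (Fin n) (Fin n) ℝ)
    (S : Matrix (Fin n) (Fin 1) ℝ) : Matrix (Fin n) (Fin 1) ℝ :=
  (Λ₁ + (1 - 1 / (N : ℝ)) • Λ₂) * p.B *
      (p.R2 Λ₁ Λ₂ - (1 / (N : ℝ)) • (p.B0ᵀ * Λ₂ * p.B0))⁻¹ *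
      (p.Bᵀ * S + p.B1ᵀ * Λ₁ * p.D + p.B0ᵀ * (Λ₁ + (1 - 1 / (N : ℝ)) • Λ₂) * p.D0)
  - (Λ₁ + Λ₂) * p.B * (p.R2 Λ₁ Λ₂)⁻¹ *
      (p.Bᵀ * S + p.B1ᵀ * Λ₁ * p.D + p.B0ᵀ * (Λ₁ + Λ₂) * p.D0)

/-- g₀₂. -/
noncomputable def g02 (N : ℕ) (Λ₁ Λ₂ : Matrix (Fin n) (Fin n) ℝ)
    (S : Matrix (Fin n) (Fin 1) ℝ) : Matrix (Fin 1) (Fin 1) ℝ :=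
  (Sᵀ * p.B + p.Dᵀ * Λ₁ * p.B1 + p.D0ᵀ * (Λ₁ + (1 - 1 / (N : ℝ)) • Λ₂) * p.B0) *
      (p.R2 Λ₁ Λ₂ - (1 / (N : ℝ)) • (p.B0ᵀ * Λ₂ * p.B0))⁻¹ *
      (p.Bᵀ * S + p.B1ᵀ * Λ₁ * p.D + p.B0ᵀ * (Λ₁ + (1 - 1 / (N : ℝ)) • Λ₂) * p.D0)
  - (Sᵀ * p.B + p.Dᵀ * Λ₁ * p.B1 + p.D0ᵀ * (Λ₁ + Λ₂) * p.B0) * (p.R2 Λ₁ Λ₂)⁻¹ *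
      (p.Bᵀ * S + p.B1ᵀ * Λ₁ * p.D + p.B0ᵀ * (Λ₁ + Λ₂) * p.D0)
  + (1 / (N : ℝ)) • (p.D0ᵀ * Λ₂ * p.D0)

/-- Solution of the rescaled companion system (ODE-S^N r^N) on [0,T]. -/
noncomputable def IsSolSrN (N : ℕ) (Λ₁ Λ₂ : ℝ → Matrix (Fin n) (Fin n) ℝ)
    (S : ℝ → Matrix (Fin n) (Fin 1) ℝ) (r : ℝ → ℝ) : Prop :=
  S p.T = 0 ∧ r p.T = 0 ∧
  (∀ t ∈ Icc (0 : ℝ) p.T, ∀ i j, HasDerivWithinAt (fun s => S s i j)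
    ((p.φ₁ (Λ₁ t) (Λ₂ t) (S t) + p.g01 N (Λ₁ t) (Λ₂ t) (S t)) i j) (Icc (0 : ℝ) p.T) t) ∧
  (∀ t ∈ Icc (0 : ℝ) p.T, HasDerivWithinAt r
    ((p.φ₂ (Λ₁ t) (Λ₂ t) (S t) + p.g02 N (Λ₁ t) (Λ₂ t) (S t)) 0 0) (Icc (0 : ℝ) p.T) t)

/-! Feedback gains. -/

/-- Θ = ℛ₁(Λ₁)⁻¹ Bᵀ Λ₁. -/
noncomputable def Theta (Λ₁ : Matrix (Fin n) (Fin n) ℝ) : Matrix (Fin n₁) (Fin n) ℝ :=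
  (p.R1 Λ₁)⁻¹ * p.Bᵀ * Λ₁

/-- Θ₁ = (H₁ − H)Bᵀ(Λ₁+Λ₂) + HBᵀΛ₂. -/
noncomputable def Theta1 (Λ₁ Λ₂ : Matrix (Fin n) (Fin n) ℝ) : Matrix (Fin n₁) (Fin n) ℝ :=
  ((p.R2 Λ₁ Λ₂)⁻¹ - (p.R1 Λ₁)⁻¹) * p.Bᵀ * (Λ₁ + Λ₂) + (p.R1 Λ₁)⁻¹ * p.Bᵀ * Λ₂

/-- Θ₂ = H₁[BᵀS + B₁ᵀΛ₁D + B₀ᵀ(Λ₁+Λ₂)D₀]. -/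
noncomputable def Theta2 (Λ₁ Λ₂ : Matrix (Fin n) (Fin n) ℝ) (S : Matrix (Fin n) (Fin 1) ℝ) :
    Matrix (Fin n₁) (Fin 1) ℝ :=
  (p.R2 Λ₁ Λ₂)⁻¹ * (p.Bᵀ * S + p.B1ᵀ * Λ₁ * p.D + p.B0ᵀ * (Λ₁ + Λ₂) * p.D0)

/-- Θ^N. -/
noncomputable def ThetaN (N : ℕ) (Λ₁ Λ₂ : Matrix (Fin n) (Fin n) ℝ) :
    Matrix (Fin n₁) (Fin n) ℝ :=
  (p.HN N Λ₁ Λ₂ - p.EN N Λ₁ Λ₂) * p.Bᵀ * (Λ₁ - (1 / (N : ℝ)) • Λ₂)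

/-- Θ₁^N. -/
noncomputable def Theta1N (N : ℕ) (Λ₁ Λ₂ : Matrix (Fin n) (Fin n) ℝ) :
    Matrix (Fin n₁) (Fin n) ℝ :=
  (N : ℝ) • (p.EN N Λ₁ Λ₂ * p.Bᵀ * Λ₁)
    + (p.HN N Λ₁ Λ₂ + ((N : ℝ) - 2) • p.EN N Λ₁ Λ₂) * p.Bᵀ * Λ₂

/-- Θ₂^N. -/
noncomputable def Theta2N (N : ℕ) (Λ₁ Λ₂ : Matrix (Fin n) (Fin n) ℝ)
    (S : Matrix (Fin n) (Fin 1) ℝ) : Matrix (Fin n₁) (Fin 1) ℝ :=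
  (p.HN N Λ₁ Λ₂ + ((N : ℝ) - 1) • p.EN N Λ₁ Λ₂) *
    (p.Bᵀ * S + p.B1ᵀ * Λ₁ * p.D + p.B0ᵀ * (Λ₁ + (1 - 1 / (N : ℝ)) • Λ₂) * p.D0)

/-- Z₀ = −B₀(Θ + Θ₁). -/
noncomputable def Z0 (Λ₁ Λ₂ : Matrix (Fin n) (Fin n) ℝ) : Matrix (Fin n) (Fin n) ℝ :=
  -(p.B0 * (p.Theta Λ₁ + p.Theta1 Λ₁ Λ₂))

/-- Z₁ = A + G − B(Θ + Θ₁). -/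
noncomputable def Z1 (Λ₁ Λ₂ : Matrix (Fin n) (Fin n) ℝ) : Matrix (Fin n) (Fin n) ℝ :=
  p.A + p.G - p.B * (p.Theta Λ₁ + p.Theta1 Λ₁ Λ₂)

/-! The high-dimensional equations under the decentralized control. -/

/-- RHS of (ODE-P̌₁) (paper's −d𝐏̌₁/dt). -/
noncomputable def Pcheck1RHS (N : ℕ) (Θ : Matrix (Fin n₁) (Fin n) ℝ)
    (P1 : Matrix (Fin N × Fin n) (Fin N × Fin n) ℝ) :
    Matrix (Fin N × Fin n) (Fin N × Fin n) ℝ :=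
  (kronIN N Θ)ᵀ * (p.bigR N + p.M2 N ((2 : ℝ) • P1)) * kronIN N Θ
    + P1 * (p.bigA N - p.bigBhat N * kronIN N Θ)
    + (p.bigA N - p.bigBhat N * kronIN N Θ)ᵀ * P1
    + p.bigQ N

/-- Solution of (ODE-P̌₁) on [0,T], with Θ(t) built from Λ₁(t). -/
noncomputable def IsSolPcheck1 (N : ℕ) (Λ₁ : ℝ → Matrix (Fin n) (Fin n) ℝ)
    (P1 : ℝ → Matrix (Fin N × Fin n) (Fin N × Fin n) ℝ) : Prop :=
  P1 p.T = p.bigQf N ∧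
  (∀ t ∈ Icc (0 : ℝ) p.T, ∀ x y, HasDerivWithinAt (fun s => P1 s x y)
    ((-(p.Pcheck1RHS N (p.Theta (Λ₁ t)) (P1 t))) x y) (Icc (0 : ℝ) p.T) t)

/-- RHS of (ODE-P̌₁₂) (paper's −d𝐏̌₁₂/dt). -/
noncomputable def Pcheck12RHS (N : ℕ) (Λ₁m Λ₂m : Matrix (Fin n) (Fin n) ℝ)
    (P1 : Matrix (Fin N × Fin n) (Fin N × Fin n) ℝ)
    (P12 : Matrix (Fin N × Fin n) (Fin n) ℝ) :
    Matrix (Fin N × Fin n) (Fin n) ℝ :=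
  (kronIN N (p.Theta Λ₁m))ᵀ * (p.bigR N + p.M2 N ((2 : ℝ) • P1)) *
      stackN N (p.Theta1 Λ₁m Λ₂m)
    - P1 * p.bigBhat N * stackN N (p.Theta1 Λ₁m Λ₂m)
    + ((p.bigA N)ᵀ - (kronIN N (p.Theta Λ₁m))ᵀ * (p.bigBhat N)ᵀ) * P12
    + P12 * p.Z1 Λ₁m Λ₂m
    - (kronIN N (p.Theta Λ₁m))ᵀ * (p.bigIhat N)ᵀ * (p.bigB0 N)ᵀ * P12 * p.Z0 Λ₁m Λ₂m

/-- Solution of (ODE-P̌₁₂) on [0,T]. -/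
noncomputable def IsSolPcheck12 (N : ℕ) (Λ₁ Λ₂ : ℝ → Matrix (Fin n) (Fin n) ℝ)
    (P1 : ℝ → Matrix (Fin N × Fin n) (Fin N × Fin n) ℝ)
    (P12 : ℝ → Matrix (Fin N × Fin n) (Fin n) ℝ) : Prop :=
  P12 p.T = 0 ∧
  (∀ t ∈ Icc (0 : ℝ) p.T, ∀ x y, HasDerivWithinAt (fun s => P12 s x y)
    ((-(p.Pcheck12RHS N (Λ₁ t) (Λ₂ t) (P1 t) (P12 t))) x y) (Icc (0 : ℝ) p.T) t)

/-! The decentralized-control low-dimensional coefficient system. -/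

/-- ǧ₁. -/
noncomputable def gc1 (N : ℕ) (Θ : Matrix (Fin n₁) (Fin n) ℝ)
    (L1 L2 : Matrix (Fin n) (Fin n) ℝ) : Matrix (Fin n) (Fin n) ℝ :=
  (1 / (N : ℝ)) •
    (Θᵀ * p.B0ᵀ * (L1 + (1 - 1 / (N : ℝ)) • L2) * p.B0 * Θ
      + (L1 + (1 - 1 / (N : ℝ)) • L2) * p.G
      + p.Gᵀ * (L1 + (1 - 1 / (N : ℝ)) • L2)
      + p.QΓ)

/-- ǧ₂. -/
noncomputable def gc2 (N : ℕ) (Θ : Matrix (Fin n₁) (Fin n) ℝ)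
    (L2 : Matrix (Fin n) (Fin n) ℝ) : Matrix (Fin n) (Fin n) ℝ :=
  -((1 / (N : ℝ)) • (Θᵀ * p.B0ᵀ * L2 * p.B0 * Θ + L2 * p.G + p.Gᵀ * L2))

/-- ǧ₁₂. -/
noncomputable def gc12 (N : ℕ) (Θ Θ₁ : Matrix (Fin n₁) (Fin n) ℝ)
    (L2 : Matrix (Fin n) (Fin n) ℝ) : Matrix (Fin n) (Fin n) ℝ :=
  (1 / (N : ℝ)) • (-(Θᵀ * p.B0ᵀ * L2 * p.B0 * Θ₁) + L2 * p.B * Θ₁)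

/-- ǧ₂₂. -/
noncomputable def gc22 (N : ℕ) (Θ₁ : Matrix (Fin n₁) (Fin n) ℝ)
    (L2 : Matrix (Fin n) (Fin n) ℝ) : Matrix (Fin n) (Fin n) ℝ :=
  -((1 / (N : ℝ)) • (Θ₁ᵀ * p.B0ᵀ * L2 * p.B0 * Θ₁))

/-- ǧ₀₁. -/
noncomputable def gc01 (N : ℕ) (Θ : Matrix (Fin n₁) (Fin n) ℝ)
    (Θ₂ : Matrix (Fin n₁) (Fin 1) ℝ) (L2 : Matrix (Fin n) (Fin n) ℝ) :
    Matrix (Fin n) (Fin 1) ℝ :=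
  (1 / (N : ℝ)) • (Θᵀ * p.B0ᵀ * L2 * (p.D0 - p.B0 * Θ₂) + L2 * p.B * Θ₂)

/-- ǧ₀₂. -/
noncomputable def gc02 (N : ℕ) (Θ₁ : Matrix (Fin n₁) (Fin n) ℝ)
    (Θ₂ : Matrix (Fin n₁) (Fin 1) ℝ) (L2 : Matrix (Fin n) (Fin n) ℝ) :
    Matrix (Fin n) (Fin 1) ℝ :=
  (1 / (N : ℝ)) • (-(Θ₁ᵀ * p.B0ᵀ * L2 * p.B0 * Θ₂) + Θ₁ᵀ * p.B0ᵀ * L2 * p.D0)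

/-- RHS of (ODE-Λ̌₁^N) (paper's −dΛ̌₁^N/dt). -/
noncomputable def check1RHS (N : ℕ) (Θ : Matrix (Fin n₁) (Fin n) ℝ)
    (L1 L2 : Matrix (Fin n) (Fin n) ℝ) : Matrix (Fin n) (Fin n) ℝ :=
  Θᵀ * p.R1 L1 * Θ + L1 * (p.A - p.B * Θ) + (p.A - p.B * Θ)ᵀ * L1 + p.Q
    + p.gc1 N Θ L1 L2

/-- RHS of (ODE-Λ̌₂^N). -/
noncomputable def check2RHS (N : ℕ) (Θ : Matrix (Fin n₁) (Fin n) ℝ)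
    (L1 L2 : Matrix (Fin n) (Fin n) ℝ) : Matrix (Fin n) (Fin n) ℝ :=
  Θᵀ * p.B0ᵀ * (L1 + L2) * p.B0 * Θ + L1 * p.G + p.Gᵀ * L1
    + L2 * (p.A + p.G - p.B * Θ) + (p.A + p.G - p.B * Θ)ᵀ * L2 + p.QΓ
    + p.gc2 N Θ L2

/-- RHS of (ODE-Λ̌₁₂^N). -/
noncomputable def check12RHS (N : ℕ) (Θ Θ₁ : Matrix (Fin n₁) (Fin n) ℝ)
    (L1 L2 L12 : Matrix (Fin n) (Fin n) ℝ) : Matrix (Fin n) (Fin n) ℝ :=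
  Θᵀ * p.R2 L1 L2 * Θ₁ + Θᵀ * p.B0ᵀ * L12 * p.B0 * (Θ + Θ₁)
    - (L1 + L2) * p.B * Θ₁
    + (p.A + p.G - p.B * Θ)ᵀ * L12
    + L12 * (p.A + p.G - p.B * (Θ₁ + Θ))
    + p.gc12 N Θ Θ₁ L2

/-- RHS of (ODE-Λ̌₂₂^N). -/
noncomputable def check22RHS (N : ℕ) (Θ₁ : Matrix (Fin n₁) (Fin n) ℝ)
    (Z₀ Z₁ : Matrix (Fin n) (Fin n) ℝ)
    (L1 L2 L12 L22 : Matrix (Fin n) (Fin n) ℝ) : Matrix (Fin n) (Fin n) ℝ :=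
  Θ₁ᵀ * p.R2 L1 L2 * Θ₁ - L12ᵀ * p.B * Θ₁ - Θ₁ᵀ * p.Bᵀ * L12
    + L22 * Z₁ + Z₁ᵀ * L22
    - Z₀ᵀ * L12ᵀ * p.B0 * Θ₁ - Θ₁ᵀ * p.B0ᵀ * L12 * Z₀
    + Z₀ᵀ * L22 * Z₀ + p.gc22 N Θ₁ L2

/-- RHS of (ODE-Š₁^N). -/
noncomputable def checkS1RHS (N : ℕ) (Θ : Matrix (Fin n₁) (Fin n) ℝ)
    (Θ₂ : Matrix (Fin n₁) (Fin 1) ℝ) (L1 L2 L12 : Matrix (Fin n) (Fin n) ℝ)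
    (S1 : Matrix (Fin n) (Fin 1) ℝ) : Matrix (Fin n) (Fin 1) ℝ :=
  Θᵀ * p.R2 L1 L2 * Θ₂ - (L1 + L2 + L12) * p.B * Θ₂
    - Θᵀ * (p.Bᵀ * S1 + p.B1ᵀ * L1 * p.D + p.B0ᵀ * (L1 + L2) * p.D0)
    - Θᵀ * p.B0ᵀ * L12 * (p.D0 - p.B0 * Θ₂)
    + (p.A + p.G)ᵀ * S1
    + p.gc01 N Θ Θ₂ L2

/-- RHS of (ODE-Š₂^N). -/
noncomputable def checkS2RHS (N : ℕ) (Θ₁ : Matrix (Fin n₁) (Fin n) ℝ)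
    (Θ₂ : Matrix (Fin n₁) (Fin 1) ℝ) (Z₀ Z₁ : Matrix (Fin n) (Fin n) ℝ)
    (L1 L2 L12 L22 : Matrix (Fin n) (Fin n) ℝ)
    (S1 S2 : Matrix (Fin n) (Fin 1) ℝ) : Matrix (Fin n) (Fin 1) ℝ :=
  Θ₁ᵀ * p.R2 L1 L2 * Θ₂ + Z₁ᵀ * S2
    - Θ₁ᵀ * (p.Bᵀ * S1 + p.B1ᵀ * L1 * p.D + p.B0ᵀ * (L1 + L2) * p.D0)
    + (Z₀ᵀ * L22 + Z₀ᵀ * L12ᵀ - Θ₁ᵀ * p.B0ᵀ * L12) * (p.D0 - p.B0 * Θ₂)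
    - (L12ᵀ + L22) * p.B * Θ₂
    + p.gc02 N Θ₁ Θ₂ L2

/-- Solution of the pair (ODE-Λ̌₁^N)–(ODE-Λ̌₂^N) on [0,T], with Θ(t) from the limiting Λ₁. -/
noncomputable def IsSolCheckA (N : ℕ) (Λ₁ : ℝ → Matrix (Fin n) (Fin n) ℝ)
    (L1 L2 : ℝ → Matrix (Fin n) (Fin n) ℝ) : Prop :=
  L1 p.T = p.Qf + (1 / (N : ℝ)) • p.QfΓ ∧ L2 p.T = p.QfΓ ∧
  (∀ t ∈ Icc (0 : ℝ) p.T, ∀ i j, HasDerivWithinAt (fun s => L1 s i j)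
    ((-(p.check1RHS N (p.Theta (Λ₁ t)) (L1 t) (L2 t))) i j) (Icc (0 : ℝ) p.T) t) ∧
  (∀ t ∈ Icc (0 : ℝ) p.T, ∀ i j, HasDerivWithinAt (fun s => L2 s i j)
    ((-(p.check2RHS N (p.Theta (Λ₁ t)) (L1 t) (L2 t))) i j) (Icc (0 : ℝ) p.T) t)

/-- Solution of (ODE-Λ̌₁^N)–(ODE-Λ̌₂₂^N) on [0,T], with Θ, Θ₁, Z₀, Z₁ from the limiting (Λ₁, Λ₂). -/
noncomputable def IsSolCheckB (N : ℕ) (Λ₁ Λ₂ : ℝ → Matrix (Fin n) (Fin n) ℝ)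
    (L1 L2 L12 L22 : ℝ → Matrix (Fin n) (Fin n) ℝ) : Prop :=
  p.IsSolCheckA N Λ₁ L1 L2 ∧
  L12 p.T = 0 ∧ L22 p.T = 0 ∧
  (∀ t ∈ Icc (0 : ℝ) p.T, ∀ i j, HasDerivWithinAt (fun s => L12 s i j)
    ((-(p.check12RHS N (p.Theta (Λ₁ t)) (p.Theta1 (Λ₁ t) (Λ₂ t))
        (L1 t) (L2 t) (L12 t))) i j) (Icc (0 : ℝ) p.T) t) ∧
  (∀ t ∈ Icc (0 : ℝ) p.T, ∀ i j, HasDerivWithinAt (fun s => L22 s i j)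
    ((-(p.check22RHS N (p.Theta1 (Λ₁ t) (Λ₂ t)) (p.Z0 (Λ₁ t) (Λ₂ t))
        (p.Z1 (Λ₁ t) (Λ₂ t)) (L1 t) (L2 t) (L12 t) (L22 t))) i j) (Icc (0 : ℝ) p.T) t)

/-- Solution of the full decentralized coefficient system on [0,T],
with Θ, Θ₁, Θ₂, Z₀, Z₁ from the limiting (Λ₁, Λ₂, S). -/
noncomputable def IsSolCheckC (N : ℕ) (Λ₁ Λ₂ : ℝ → Matrix (Fin n) (Fin n) ℝ)
    (S : ℝ → Matrix (Fin n) (Fin 1) ℝ)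
    (L1 L2 L12 L22 : ℝ → Matrix (Fin n) (Fin n) ℝ)
    (S1 S2 : ℝ → Matrix (Fin n) (Fin 1) ℝ) : Prop :=
  p.IsSolCheckB N Λ₁ Λ₂ L1 L2 L12 L22 ∧
  S1 p.T = 0 ∧ S2 p.T = 0 ∧
  (∀ t ∈ Icc (0 : ℝ) p.T, ∀ i j, HasDerivWithinAt (fun s => S1 s i j)
    ((-(p.checkS1RHS N (p.Theta (Λ₁ t)) (p.Theta2 (Λ₁ t) (Λ₂ t) (S t))
        (L1 t) (L2 t) (L12 t) (S1 t))) i j) (Icc (0 : ℝ) p.T) t) ∧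
  (∀ t ∈ Icc (0 : ℝ) p.T, ∀ i j, HasDerivWithinAt (fun s => S2 s i j)
    ((-(p.checkS2RHS N (p.Theta1 (Λ₁ t) (Λ₂ t)) (p.Theta2 (Λ₁ t) (Λ₂ t) (S t))
        (p.Z0 (Λ₁ t) (Λ₂ t)) (p.Z1 (Λ₁ t) (Λ₂ t))
        (L1 t) (L2 t) (L12 t) (L22 t) (S1 t) (S2 t))) i j) (Icc (0 : ℝ) p.T) t)

end Params

section ParametricODE

open Topology Filter

open scoped NNReal Manifold ContDiff

/-- A map that is `C¹` near each point of a compact set agrees near that set with a globally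
Lipschitz, bounded map. -/
theorem exists_lipschitz_bounded_extension {V W : Type*} [NormedAddCommGroup V] [NormedSpace ℝ V]
    [FiniteDimensional ℝ V] [NormedAddCommGroup W] [NormedSpace ℝ W]
    {F : V → W} {K : Set V} (hK : IsCompact K) (hF : ∀ z ∈ K, ContDiffAt ℝ 1 F z) :
    ∃ F' : V → W, ∃ L M : ℝ≥0, LipschitzWith L F' ∧ (∀ z, ‖F' z‖ ≤ M) ∧
      ∀ z ∈ K, ∀ᶠ y in 𝓝 z, F' y = F y := by
  have hU : IsOpen {z | ContDiffAt ℝ 1 F z} :=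
    isOpen_iff_mem_nhds.2 fun z hz => ContDiffAt.eventually (𝕜 := ℝ) (n := 1) hz (by simp)
  have : ProperSpace V := FiniteDimensional.proper ℝ V
  obtain ⟨K', hK', hKK', hK'U⟩ := exists_compact_between hK hU hF
  obtain ⟨χ, hχ1, hχ0, -⟩ :=
    exists_contMDiffMap_one_nhds_of_subset_interior (n := 1) 𝓘(ℝ, V) hK.isClosed hKK'
  have hχ : ContDiff ℝ 1 χ := contMDiff_iff_contDiff.1 χ.contMDiff
  have hsupp : tsupport (fun z => χ z • F z) ⊆ K' :=
    closure_minimal (fun z hz => by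
      by_contra h
      exact hz (by simp [hχ0 z h])) hK'.isClosed
  have hc : HasCompactSupport (fun z => χ z • F z) := hK'.of_isClosed_subset isClosed_closure hsupp
  have hsm : ContDiff ℝ 1 (fun z => χ z • F z) :=
    contMDiff_iff_contDiff.1 (contMDiff_of_tsupport fun z hz =>
      (hχ.contDiffAt.smul (hK'U (hsupp hz))).contMDiffAt)
  obtain ⟨L, hL⟩ := hsm.lipschitzWith_of_hasCompactSupport hc (by simp)
  obtain ⟨M, hM⟩ := hc.exists_bound_of_continuous hsm.continuous
  refine ⟨_, L, M.toNNReal, hL, fun z => (hM z).trans (Real.le_coe_toNNReal M), fun z hz => ?_⟩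
  filter_upwards [eventually_nhdsSet_iff_forall.1 hχ1 z hz] with y hy
  simp [hy]

/-- Terminal value problems for bounded Lipschitz autonomous fields have global solutions. -/
theorem exists_terminal_solution {E : Type*} [NormedAddCommGroup E] [NormedSpace ℝ E]
    [CompleteSpace E] {f : E → E} {L M : ℝ≥0} (hL : LipschitzWith L f) (hM : ∀ z, ‖f z‖ ≤ M)
    {T : ℝ} (hT : 0 ≤ T) (a : E) :
    ∃ γ : ℝ → E, γ T = a ∧ ∀ t ∈ Icc 0 T, HasDerivWithinAt γ (f (γ t)) (Icc 0 T) t := by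
  have : IsPicardLindelof (fun _ : ℝ => f) (⟨T, hT, le_rfl⟩ : Icc (0 : ℝ) T) a
      (M * T.toNNReal) 0 M L :=
    { lipschitzOnWith := fun _ _ => hL.lipschitzOnWith
      continuousOn := fun _ _ => continuousOn_const
      norm_le := fun _ _ z _ => hM z
      mul_max_le := by simp [hT] }
  exact this.exists_eq_forall_mem_Icc_hasDerivWithinAt₀

/-- Grönwall estimate for the dependence of a terminal value problem on its parameter. -/
theorem dist_le_of_terminal_solutions {E : Type*} [NormedAddCommGroup E] [NormedSpace ℝ E]
    {F : ℝ × E → E} {L : ℝ≥0} (hL : LipschitzWith L F) {T ε δ : ℝ} {γ η : ℝ → E}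
    (hγ : ∀ t ∈ Icc 0 T, HasDerivWithinAt γ (F (ε, γ t)) (Icc 0 T) t)
    (hη : ∀ t ∈ Icc 0 T, HasDerivWithinAt η (F (δ, η t)) (Icc 0 T) t)
    (hT : γ T = η T) {t : ℝ} (ht : t ∈ Icc 0 T) :
    dist (γ t) (η t) ≤ gronwallBound 0 L (L * |ε - δ|) T := by
  have hrev : ∀ {ζ : ℝ → E} {v : E → E},
      (∀ t ∈ Icc 0 T, HasDerivWithinAt ζ (v (ζ t)) (Icc 0 T) t) →
      ∀ s ∈ Icc 0 T, HasDerivWithinAt (fun s => ζ (T - s)) (-v (ζ (T - s))) (Icc 0 T) s := by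
    intro ζ v h s hs
    have h1 : HasDerivWithinAt (fun s : ℝ => T - s) (-1) (Icc 0 T) s :=
      ((hasDerivAt_id s).const_sub T).hasDerivWithinAt
    have h2 := (h (T - s) ⟨by linarith [hs.2], by linarith [hs.1]⟩).scomp s h1
      (fun r hr => ⟨by linarith [hr.2], by linarith [hr.1]⟩)
    simpa [Function.comp_def] using h2
  have hγ' := hrev (v := fun x => F (ε, x)) hγ
  have hη' := hrev (v := fun x => F (δ, x)) hη
  have hIci : ∀ {ζ : ℝ → E} {ζ' : E} {s : ℝ}, s ∈ Ico 0 T → HasDerivWithinAt ζ ζ' (Icc 0 T) s →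
      HasDerivWithinAt ζ ζ' (Ici s) s := fun hs h =>
    h.mono_of_mem_nhdsWithin (mem_of_superset (Icc_mem_nhdsGE hs.2) (Icc_subset_Icc_left hs.1))
  have key := dist_le_of_approx_trajectories_ODE (v := fun _ x => -F (δ, x)) (K := L)
    (εf := L * |ε - δ|) (εg := 0) (δ := 0) (a := 0) (b := T)
    (f := fun s => γ (T - s)) (g := fun s => η (T - s))
    (fun _ => (hL.comp (LipschitzWith.prodMk_left (β := E) δ)).neg.weaken (by simp))
    (fun s hs => (hγ' s hs).continuousWithinAt)
    (fun s hs => hIci hs (hγ' s (Ico_subset_Icc_self hs)))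
    (fun s _ => by
      rw [dist_neg_neg]
      refine (hL.dist_le_mul _ _).trans_eq ?_
      simp [Prod.dist_eq, Real.dist_eq])
    (fun s hs => (hη' s hs).continuousWithinAt)
    (fun s hs => hIci hs (hη' s (Ico_subset_Icc_self hs)))
    (fun s _ => by simp) (by simp [hT])
  have h1 := key (T - t) ⟨by linarith [ht.2], by linarith [ht.1]⟩
  simp only [sub_sub_cancel, add_zero, sub_zero] at h1
  exact h1.trans (gronwallBound_mono le_rfl (by positivity) L.2 (by linarith [ht.1]))

theorem tendsto_gronwallBound_zero (L : ℝ≥0) (T : ℝ) :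
    Tendsto (fun ε : ℝ => gronwallBound 0 L (L * |ε|) T) (𝓝 0) (𝓝 0) := by
  have h : Continuous fun ε : ℝ => gronwallBound 0 L (L * |ε|) T :=
    (gronwallBound_continuous_ε 0 L T).comp (by fun_prop)
  simpa [gronwallBound_ε0_δ0] using h.tendsto 0

/-- Uniqueness for a terminal value problem whose field is `C¹` at each point of a compact set
containing both solutions. -/
theorem eq_of_terminal_solutions {E : Type*} [NormedAddCommGroup E] [NormedSpace ℝ E]
    [FiniteDimensional ℝ E] {f : E → E} {K : Set E} (hK : IsCompact K)
    (hf : ∀ z ∈ K, ContDiffAt ℝ 1 f z) {T : ℝ} {γ η : ℝ → E}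
    (hγ : ∀ t ∈ Icc 0 T, HasDerivWithinAt γ (f (γ t)) (Icc 0 T) t)
    (hη : ∀ t ∈ Icc 0 T, HasDerivWithinAt η (f (η t)) (Icc 0 T) t)
    (hγK : ∀ t ∈ Icc 0 T, γ t ∈ K) (hηK : ∀ t ∈ Icc 0 T, η t ∈ K)
    (hT : γ T = η T) {t : ℝ} (ht : t ∈ Icc 0 T) : γ t = η t := by
  obtain ⟨F, L, M, hL, -, hFf⟩ := exists_lipschitz_bounded_extension hK hf
  have h := dist_le_of_terminal_solutions (F := fun z : ℝ × E => F z.2) (ε := 0) (δ := 0)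
    (hL.comp LipschitzWith.prod_snd)
    (fun t ht => by rw [(hFf _ (hγK t ht)).self_of_nhds]; exact hγ t ht)
    (fun t ht => by rw [(hFf _ (hηK t ht)).self_of_nhds]; exact hη t ht) hT ht
  simpa [gronwallBound_ε0_δ0] using h

/-- Solutions of a parametric terminal value problem that stay in a compact set for a sequence of
parameters tending to `0` give, in the limit, a solution in that set for the parameter `0`. -/
theorem exists_limit_terminal_solution {E : Type*} [NormedAddCommGroup E] [NormedSpace ℝ E]
    [FiniteDimensional ℝ E] {F : ℝ × E → E} {K : Set (ℝ × E)} (hK : IsCompact K)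
    (hF : ∀ z ∈ K, ContDiffAt ℝ 1 F z) {T : ℝ} (hT : 0 ≤ T) {e : ℕ → ℝ} {a : E}
    (he : Tendsto e atTop (𝓝 0))
    (hsol : ∀ᶠ k in atTop, ∃ γ : ℝ → E, γ T = a ∧ (∀ t ∈ Icc 0 T, (e k, γ t) ∈ K) ∧
      ∀ t ∈ Icc 0 T, HasDerivWithinAt γ (F (e k, γ t)) (Icc 0 T) t) :
    ∃ γ : ℝ → E, γ T = a ∧ (∀ t ∈ Icc 0 T, (0, γ t) ∈ K) ∧
      ∀ t ∈ Icc 0 T, HasDerivWithinAt γ (F (0, γ t)) (Icc 0 T) t := by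
  obtain ⟨F', L, M, hL, hM, hF'⟩ := exists_lipschitz_bounded_extension hK hF
  have : CompleteSpace E := FiniteDimensional.complete ℝ E
  obtain ⟨η, hηT, hη⟩ := exists_terminal_solution (f := fun x => F' (0, x))
    (hL.comp (LipschitzWith.prodMk_left (β := E) (0 : ℝ))) (fun z => hM _) hT a
  have hmem : ∀ t ∈ Icc 0 T, (0, η t) ∈ K := by
    intro t ht
    choose! γ hγ using fun k (hk : ∃ γ : ℝ → E, γ T = a ∧ (∀ t ∈ Icc 0 T, (e k, γ t) ∈ K) ∧
      ∀ t ∈ Icc 0 T, HasDerivWithinAt γ (F (e k, γ t)) (Icc 0 T) t) => hk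
    have hlim : Tendsto (fun k => γ k t) atTop (𝓝 (η t)) := by
      rw [tendsto_iff_dist_tendsto_zero]
      refine squeeze_zero' (Eventually.of_forall fun _ => dist_nonneg) ?_
        ((tendsto_gronwallBound_zero L T).comp he)
      filter_upwards [hsol] with k hk
      obtain ⟨h1, h2, h3⟩ := hγ k hk
      have := dist_le_of_terminal_solutions (ε := e k) (δ := 0) hL
        (fun t ht => by rw [(hF' _ (h2 t ht)).self_of_nhds]; exact h3 t ht) hη
        (h1.trans hηT.symm) ht
      simpa using this
    refine hK.isClosed.mem_of_tendsto (he.prodMk_nhds hlim) ?_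
    filter_upwards [hsol] with k hk using (hγ k hk).2.1 t ht
  exact ⟨η, hηT, hmem, fun t ht => by
    rw [← (hF' _ (hmem t ht)).self_of_nhds]; exact hη t ht⟩

/-- A solution of a terminal value problem for the parameter `0` persists for small parameters,
uniformly close to the original solution. -/
theorem eventually_exists_terminal_solution {E : Type*} [NormedAddCommGroup E] [NormedSpace ℝ E]
    [FiniteDimensional ℝ E] {F : ℝ × E → E} {T : ℝ} (hT : 0 ≤ T) {γ : ℝ → E}
    (hF : ∀ t ∈ Icc 0 T, ContDiffAt ℝ 1 F (0, γ t))
    (hγ : ∀ t ∈ Icc 0 T, HasDerivWithinAt γ (F (0, γ t)) (Icc 0 T) t)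
    {P : ℝ × E → Prop} (hP : ∀ t ∈ Icc 0 T, ∀ᶠ z in 𝓝 (0, γ t), P z) :
    ∀ᶠ ε in 𝓝 (0 : ℝ), ∃ η : ℝ → E, η T = γ T ∧ (∀ t ∈ Icc 0 T, P (ε, η t)) ∧
      ∀ t ∈ Icc 0 T, HasDerivWithinAt η (F (ε, η t)) (Icc 0 T) t := by
  have hcont : ContinuousOn γ (Icc 0 T) := fun t ht => (hγ t ht).continuousWithinAt
  have hK : IsCompact ((fun t => ((0 : ℝ), γ t)) '' Icc 0 T) :=
    isCompact_Icc.image_of_continuousOn (continuousOn_const.prodMk hcont)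
  obtain ⟨F', L, M, hL, hM, hF'⟩ := exists_lipschitz_bounded_extension hK (F := F) (by
    rintro _ ⟨t, ht, rfl⟩; exact hF t ht)
  have hnear : ∀ᶠ h in 𝓝 (0 : ℝ × E), ∀ z ∈ (fun t => ((0 : ℝ), γ t)) '' Icc 0 T,
      P (z + h) ∧ F' (z + h) = F (z + h) := by
    refine hK.eventually_forall_of_forall_eventually fun z hz => ?_
    have hlim : Tendsto (fun w : (ℝ × E) × (ℝ × E) => w.2 + w.1) (𝓝 (0, z)) (𝓝 z) := by
      have : Continuous fun w : (ℝ × E) × (ℝ × E) => w.2 + w.1 := by fun_prop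
      simpa using this.tendsto (0, z)
    have hPz : ∀ᶠ y in 𝓝 z, P y := by
      obtain ⟨t, ht, rfl⟩ := hz
      exact hP t ht
    exact hlim.eventually (hPz.and (hF' z hz))
  obtain ⟨r, hr, hball⟩ := Metric.eventually_nhds_iff.1 hnear
  have : CompleteSpace E := FiniteDimensional.complete ℝ E
  filter_upwards [(tendsto_gronwallBound_zero L T).eventually_lt_const hr,
    Metric.ball_mem_nhds (0 : ℝ) hr] with ε hε hεr
  obtain ⟨η, hηT, hη⟩ := exists_terminal_solution (f := fun x => F' (ε, x))
    (hL.comp (LipschitzWith.prodMk_left (β := E) ε)) (fun z => hM _) hT (γ T)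
  have hclose : ∀ t ∈ Icc 0 T, P (ε, η t) ∧ F' (ε, η t) = F (ε, η t) := by
    intro t ht
    have hd := dist_le_of_terminal_solutions (ε := ε) (δ := 0) hL hη
      (fun t ht => by rw [(hF' _ ⟨t, ht, rfl⟩).self_of_nhds]; exact hγ t ht) hηT ht
    have := hball (y := (ε, η t - γ t)) (by
      rw [Prod.dist_eq, max_lt_iff]
      refine ⟨hεr, ?_⟩
      rw [sub_zero] at hd
      simpa [dist_eq_norm] using hd.trans_lt hε) _ ⟨t, ht, rfl⟩
    simpa using this
  exact ⟨η, hηT, fun t ht => (hclose t ht).1, fun t ht => by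
    rw [← (hclose t ht).2]; exact hη t ht⟩

end ParametricODE

section MatrixAnalysis

open Topology Filter

attribute [local instance] Matrix.normedAddCommGroup Matrix.normedSpace

variable {m k l : Type*} [Fintype m] [Fintype k] [Fintype l]

/-- The right-hand side of a Riccati equation with control weight `Z`. -/
noncomputable def ric [DecidableEq k] (A : Matrix m m ℝ) (B : Matrix m k ℝ) (Q : Matrix m m ℝ)
    (Z : Matrix k k ℝ) (X : Matrix m m ℝ) : Matrix m m ℝ :=
  X * B * Z⁻¹ * Bᵀ * X - X * A - Aᵀ * X - Q

theorem ric_transpose [DecidableEq k] {A : Matrix m m ℝ} {B : Matrix m k ℝ} {Q : Matrix m m ℝ}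
    {Z : Matrix k k ℝ} {X : Matrix m m ℝ} (hQ : Q.IsSymm) :
    (ric A B Q Z X)ᵀ = ric A B Q Zᵀ Xᵀ := by
  simp only [ric, transpose_sub, transpose_mul, transpose_transpose, transpose_nonsing_inv, hQ.eq,
    Matrix.mul_assoc]
  abel

section ContDiff

variable {V : Type*} [NormedAddCommGroup V] [NormedSpace ℝ V] {v : V}

theorem contDiffAt_matrix {f : V → Matrix m k ℝ} :
    ContDiffAt ℝ 1 f v ↔ ∀ i j, ContDiffAt ℝ 1 (fun z => f z i j) v := by
  refine contDiffAt_pi.trans (forall_congr' fun i => ?_)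
  exact contDiffAt_pi

theorem hasDerivWithinAt_matrix {m k : Type*} [Fintype k] {f : ℝ → Matrix m k ℝ}
    {f' : Matrix m k ℝ} {s : Set ℝ} {t : ℝ} :
    HasDerivWithinAt f f' s t ↔ ∀ i j, HasDerivWithinAt (fun z => f z i j) (f' i j) s t := by
  refine hasDerivWithinAt_pi.trans (forall_congr' fun i => ?_)
  exact hasDerivWithinAt_pi

theorem contDiffAt_matrix_mul {f : V → Matrix m k ℝ} {g : V → Matrix k l ℝ}
    (hf : ContDiffAt ℝ 1 f v) (hg : ContDiffAt ℝ 1 g v) :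
    ContDiffAt ℝ 1 (fun z => f z * g z) v := by
  rw [contDiffAt_matrix] at *
  intro i j
  simp only [mul_apply]
  exact ContDiffAt.sum fun a _ => (hf i a).mul (hg a j)

theorem contDiffAt_matrix_det [DecidableEq k] {f : V → Matrix k k ℝ}
    (hf : ContDiffAt ℝ 1 f v) : ContDiffAt ℝ 1 (fun z => (f z).det) v := by
  rw [contDiffAt_matrix] at hf
  simp only [det_apply]
  exact ContDiffAt.sum fun σ _ => (contDiffAt_prod fun i _ => hf _ _).const_smul _

theorem contDiffAt_matrix_inv [DecidableEq k] {f : V → Matrix k k ℝ}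
    (hf : ContDiffAt ℝ 1 f v) (hu : IsUnit (f v)) : ContDiffAt ℝ 1 (fun z => (f z)⁻¹) v := by
  have hdet : (f v).det ≠ 0 := ((Matrix.isUnit_iff_isUnit_det _).1 hu).ne_zero
  refine contDiffAt_matrix.2 fun i j => ?_
  simp only [inv_def, Ring.inverse_eq_inv']
  simp only [Matrix.smul_apply, smul_eq_mul, adjugate_apply]
  refine ((contDiffAt_matrix_det hf).inv hdet).mul (contDiffAt_matrix_det ?_)
  rw [contDiffAt_matrix] at *
  intro a b
  simp only [updateRow_apply]
  split_ifs
  · exact contDiffAt_const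
  · exact hf a b

theorem contDiffAt_ric [DecidableEq k] (A : Matrix m m ℝ) (B : Matrix m k ℝ) (Q : Matrix m m ℝ)
    {Z : V → Matrix k k ℝ} {X : V → Matrix m m ℝ} (hZ : ContDiffAt ℝ 1 Z v)
    (hX : ContDiffAt ℝ 1 X v) (hu : IsUnit (Z v)) :
    ContDiffAt ℝ 1 (fun z => ric A B Q (Z z) (X z)) v := by
  unfold ric
  refine ContDiffAt.sub (ContDiffAt.sub (ContDiffAt.sub ?_ ?_) ?_) contDiffAt_const
  · exact contDiffAt_matrix_mul (contDiffAt_matrix_mul (contDiffAt_matrix_mul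
      (contDiffAt_matrix_mul hX contDiffAt_const) (contDiffAt_matrix_inv hZ hu))
      contDiffAt_const) hX
  · exact contDiffAt_matrix_mul hX contDiffAt_const
  · exact contDiffAt_matrix_mul contDiffAt_const hX

end ContDiff

theorem isClosed_setOf_posSemidef : IsClosed {M : Matrix k k ℝ | M.PosSemidef} := by
  simp only [posSemidef_iff_dotProduct_mulVec, ofPred_and, ofPred_forall]
  refine IsClosed.inter (isClosed_eq (by fun_prop) continuous_id) (isClosed_iInter fun x => ?_)
  exact isClosed_le continuous_const (by fun_prop)

theorem isCompact_setOf_dotProduct_self_eq_one : IsCompact {x : k → ℝ | x ⬝ᵥ x = 1} := by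
  refine Metric.isCompact_of_isClosed_isBounded (isClosed_eq (by fun_prop) continuous_const)
    ((Metric.isBounded_closedBall (x := (0 : k → ℝ)) (r := 1)).subset fun x hx => ?_)
  rw [mem_closedBall_zero_iff, pi_norm_le_iff_of_nonneg zero_le_one]
  intro i
  have h : x i * x i ≤ x ⬝ᵥ x :=
    Finset.single_le_sum (f := fun i => x i * x i) (fun j _ => mul_self_nonneg _)
      (Finset.mem_univ i)
  rw [mem_ofPred_eq] at hx
  rw [Real.norm_eq_abs, ← sq_le_one_iff_abs_le_one]
  nlinarith

theorem posSemidef_of_forall_dotProduct_self_eq_one {M : Matrix k k ℝ} (hM : M.IsSymm)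
    (h : ∀ x : k → ℝ, x ⬝ᵥ x = 1 → 0 ≤ x ⬝ᵥ M *ᵥ x) : M.PosSemidef := by
  refine PosSemidef.of_dotProduct_mulVec_nonneg (hM : Mᴴ = M) fun x => ?_
  rw [star_trivial]
  by_cases hx : x = 0
  · simp [hx]
  have hpos : 0 < x ⬝ᵥ x := by
    have := dotProduct_star_self_pos_iff.2 hx
    simpa using this
  have hr := Real.sqrt_pos.2 hpos
  have hsq := Real.mul_self_sqrt hpos.le
  set r := Real.sqrt (x ⬝ᵥ x)
  have h1 := h (r⁻¹ • x) (by
    simp only [smul_dotProduct, dotProduct_smul, smul_eq_mul, ← hsq]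
    field_simp)
  simp only [smul_dotProduct, dotProduct_smul, mulVec_smul, smul_eq_mul] at h1
  rw [← mul_assoc] at h1
  exact (mul_nonneg_iff_of_pos_left (by positivity)).1 h1

theorem exists_forall_eventually_posSemidef_sub [DecidableEq k] {K : Set (Matrix k k ℝ)}
    (hK : IsCompact K) (h : ∀ M ∈ K, M.PosDef) :
    ∃ c : ℝ, 0 < c ∧ ∀ M ∈ K, ∀ᶠ M' in 𝓝 M, M'.IsSymm → (M' - c • 1).PosSemidef := by
  set S := {x : k → ℝ | x ⬝ᵥ x = 1} with hS
  have hSc : IsCompact S := isCompact_setOf_dotProduct_self_eq_one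
  have hcont : Continuous fun z : Matrix k k ℝ × (k → ℝ) => z.2 ⬝ᵥ z.1 *ᵥ z.2 := by fun_prop
  obtain ⟨c, hc, hcK⟩ : ∃ c : ℝ, 0 < c ∧ ∀ z ∈ K ×ˢ S, c < z.2 ⬝ᵥ z.1 *ᵥ z.2 := by
    rcases (K ×ˢ S).eq_empty_or_nonempty with he | hne
    · exact ⟨1, one_pos, by simp [he]⟩
    obtain ⟨z, hz, hmin⟩ := (hK.prod hSc).exists_isMinOn hne hcont.continuousOn
    have hz0 : z.2 ≠ 0 := by
      intro h0
      have := hz.2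
      simp [hS, h0] at this
    have hpos := (h z.1 hz.1).dotProduct_mulVec_pos hz0
    rw [star_trivial] at hpos
    exact ⟨_, half_pos hpos, fun w hw => (half_lt_self hpos).trans_le (hmin hw)⟩
  refine ⟨c, hc, fun M hM => ?_⟩
  have hev : ∀ᶠ M' in 𝓝 M, ∀ x ∈ S, c < x ⬝ᵥ M' *ᵥ x :=
    hSc.eventually_forall_of_forall_eventually fun x hx =>
      (hcont.tendsto (M, x)).eventually (lt_mem_nhds (hcK (M, x) ⟨hM, hx⟩))
  filter_upwards [hev] with M' hM' hsymm
  refine posSemidef_of_forall_dotProduct_self_eq_one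
    (hsymm.sub (by rw [IsSymm, transpose_smul, transpose_one])) fun x hx => ?_
  have := hM' x hx
  simp only [sub_mulVec, dotProduct_sub, smul_mulVec, one_mulVec, dotProduct_smul, smul_eq_mul, hx]
  linarith

theorem posDef_of_posSemidef_sub_smul_one {k : Type*} [DecidableEq k] {M : Matrix k k ℝ}
    {c : ℝ} (hc : 0 < c)
    (h : (M - c • 1).PosSemidef) : M.PosDef := by
  simpa using PosDef.posSemidef_add h (PosDef.one.smul hc)

theorem norm_le_of_forall_abs_le {M : Matrix m k ℝ} {C : ℝ} (hC : 0 ≤ C)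
    (h : ∀ i j, |M i j| ≤ C) : ‖M‖ ≤ C :=
  (Matrix.norm_le_iff hC).2 h

end MatrixAnalysis

section ReducedSystem

open Topology Filter

attribute [local instance] Matrix.normedAddCommGroup Matrix.normedSpace

variable {n n₁ : ℕ} (p : Params n n₁)

theorem Params.isSymm_QΓ (hQ : p.Q.IsSymm) : p.QΓ.IsSymm := by
  simp only [IsSymm, Params.QΓ, transpose_sub, transpose_mul, transpose_transpose, hQ.eq,
    Matrix.mul_assoc]
  abel

/-- The control weight acting on deviations from the mean, with `ε = 1 / N`. -/
def Params.midDev (ε : ℝ) (X W : Matrix (Fin n) (Fin n) ℝ) : Matrix (Fin n₁) (Fin n₁) ℝ :=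
  p.R1 (X + ε • (W - X))

/-- The control weight acting on the mean, with `ε = 1 / N`. -/
def Params.midMean (ε : ℝ) (X W : Matrix (Fin n) (Fin n) ℝ) : Matrix (Fin n₁) (Fin n₁) ℝ :=
  p.midDev ε X W + p.B0ᵀ * W * p.B0

/-- The vector field of the Riccati system for the deviation part and the mean part. -/
noncomputable def Params.field
    (z : ℝ × (Matrix (Fin n) (Fin n) ℝ × Matrix (Fin n) (Fin n) ℝ)) :
    Matrix (Fin n) (Fin n) ℝ × Matrix (Fin n) (Fin n) ℝ :=
  (ric p.A p.B p.Q (p.midDev z.1 z.2.1 z.2.2) z.2.1,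
    ric (p.A + p.G) p.B (p.Q + p.QΓ) (p.midMean z.1 z.2.1 z.2.2) z.2.2)

/-- A symmetric solution of the Riccati system for the deviation part and the mean part. -/
def Params.IsSolEps (ε : ℝ) (γ : ℝ → Matrix (Fin n) (Fin n) ℝ × Matrix (Fin n) (Fin n) ℝ) :
    Prop :=
  (∀ t ∈ Icc 0 p.T, (γ t).1.IsSymm ∧ (γ t).2.IsSymm) ∧ γ p.T = (p.Qf, p.Qf + p.QfΓ) ∧
    ∀ t ∈ Icc 0 p.T, HasDerivWithinAt γ (p.field (ε, γ t)) (Icc 0 p.T) t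

/-- Uniform bounds and uniform positivity of both control weights. -/
def Params.Admissible (c C ε : ℝ) (x : Matrix (Fin n) (Fin n) ℝ × Matrix (Fin n) (Fin n) ℝ) :
    Prop :=
  (p.midDev ε x.1 x.2 - c • 1).PosSemidef ∧ (p.midMean ε x.1 x.2 - c • 1).PosSemidef ∧
    ‖x‖ ≤ C

theorem Params.isSymm_midDev (hR : p.R.IsSymm) (ε : ℝ) {X W : Matrix (Fin n) (Fin n) ℝ}
    (hX : X.IsSymm) (hW : W.IsSymm) : (p.midDev ε X W).IsSymm := by
  simp only [IsSymm, Params.midDev, Params.R1, transpose_add, transpose_mul, transpose_transpose,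
    transpose_smul, transpose_sub, hR.eq, hX.eq, hW.eq, Matrix.mul_assoc]

theorem Params.isSymm_midMean (hR : p.R.IsSymm) (ε : ℝ) {X W : Matrix (Fin n) (Fin n) ℝ}
    (hX : X.IsSymm) (hW : W.IsSymm) : (p.midMean ε X W).IsSymm := by
  have h := (p.isSymm_midDev hR ε hX hW).eq
  simp only [IsSymm, Params.midMean, transpose_add, transpose_mul, transpose_transpose,
    h, hW.eq, Matrix.mul_assoc]

theorem Params.isSymm_field (hR : p.R.IsSymm) (hQ : p.Q.IsSymm) {ε : ℝ}
    {x : Matrix (Fin n) (Fin n) ℝ × Matrix (Fin n) (Fin n) ℝ}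
    (hX : x.1.IsSymm) (hW : x.2.IsSymm) :
    (p.field (ε, x)).1.IsSymm ∧ (p.field (ε, x)).2.IsSymm := by
  refine ⟨?_, ?_⟩
  · simp only [IsSymm, Params.field]
    rw [ric_transpose hQ, (p.isSymm_midDev hR ε hX hW).eq, hX.eq]
  · simp only [IsSymm, Params.field]
    rw [ric_transpose (hQ.add (p.isSymm_QΓ hQ)), (p.isSymm_midMean hR ε hX hW).eq, hW.eq]

theorem Params.contDiff_midDev : ContDiff ℝ 1
    fun z : ℝ × (Matrix (Fin n) (Fin n) ℝ × Matrix (Fin n) (Fin n) ℝ) =>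
      p.midDev z.1 z.2.1 z.2.2 := by
  refine contDiff_iff_contDiffAt.2 fun z => ?_
  refine contDiffAt_const.add (contDiffAt_matrix_mul (contDiffAt_matrix_mul contDiffAt_const ?_)
    contDiffAt_const)
  fun_prop

theorem Params.contDiff_midMean : ContDiff ℝ 1
    fun z : ℝ × (Matrix (Fin n) (Fin n) ℝ × Matrix (Fin n) (Fin n) ℝ) =>
      p.midMean z.1 z.2.1 z.2.2 := by
  refine contDiff_iff_contDiffAt.2 fun z => ?_
  refine p.contDiff_midDev.contDiffAt.add (contDiffAt_matrix_mul
    (contDiffAt_matrix_mul contDiffAt_const ?_) contDiffAt_const)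
  fun_prop

theorem Params.contDiffAt_field
    {z : ℝ × (Matrix (Fin n) (Fin n) ℝ × Matrix (Fin n) (Fin n) ℝ)}
    (h₁ : (p.midDev z.1 z.2.1 z.2.2).PosDef) (h₂ : (p.midMean z.1 z.2.1 z.2.2).PosDef) :
    ContDiffAt ℝ 1 p.field z :=
  (contDiffAt_ric p.A p.B p.Q p.contDiff_midDev.contDiffAt (by fun_prop) h₁.isUnit).prodMk
    (contDiffAt_ric (p.A + p.G) p.B (p.Q + p.QΓ) p.contDiff_midMean.contDiffAt (by fun_prop)
      h₂.isUnit)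

theorem Params.isCompact_admissible (c C : ℝ) : IsCompact
    {z : ℝ × (Matrix (Fin n) (Fin n) ℝ × Matrix (Fin n) (Fin n) ℝ) |
      z.1 ∈ Icc (0 : ℝ) 1 ∧ (z.2.1.IsSymm ∧ z.2.2.IsSymm) ∧ p.Admissible c C z.1 z.2} := by
  have hsub : Continuous fun M : Matrix (Fin n₁) (Fin n₁) ℝ => M - c • 1 := by fun_prop
  have hcl : IsClosed {z : ℝ × (Matrix (Fin n) (Fin n) ℝ × Matrix (Fin n) (Fin n) ℝ) |
      z.1 ∈ Icc (0 : ℝ) 1 ∧ (z.2.1.IsSymm ∧ z.2.2.IsSymm) ∧ p.Admissible c C z.1 z.2} := by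
    refine (isClosed_Icc.preimage continuous_fst).inter (((isClosed_eq ?_ ?_).inter
      (isClosed_eq ?_ ?_)).inter ((isClosed_setOf_posSemidef.preimage
        (hsub.comp p.contDiff_midDev.continuous)).inter ((isClosed_setOf_posSemidef.preimage
        (hsub.comp p.contDiff_midMean.continuous)).inter (?_ : IsClosed
          {z : ℝ × (Matrix (Fin n) (Fin n) ℝ × Matrix (Fin n) (Fin n) ℝ) |
          ‖z.2‖ ≤ C}))))
    all_goals first | exact isClosed_le (by fun_prop) continuous_const | fun_prop
  refine ((isCompact_Icc (a := (0 : ℝ)) (b := 1)).prod (isCompact_closedBall 0 C)).of_isClosed_subset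
    hcl ?_
  rintro z ⟨h1, -, -, -, h2⟩
  exact ⟨h1, mem_closedBall_zero_iff.2 h2⟩

/-- A bounded family of reduced solutions with `ε → 0` yields a solution for `ε = 0`. -/
theorem Params.exists_isSolEps_zero (hT : 0 ≤ p.T) {c C : ℝ} (hc : 0 < c)
    (h : ∀ᶠ N : ℕ in atTop, ∃ γ, p.IsSolEps (1 / (N : ℝ)) γ ∧
      ∀ t ∈ Icc 0 p.T, p.Admissible c C (1 / (N : ℝ)) (γ t)) :
    ∃ γ, p.IsSolEps 0 γ ∧ ∀ t ∈ Icc 0 p.T,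
      (p.midDev 0 (γ t).1 (γ t).2).PosDef ∧ (p.midMean 0 (γ t).1 (γ t).2).PosDef := by
  have hF : ∀ z ∈ {z : ℝ × (Matrix (Fin n) (Fin n) ℝ × Matrix (Fin n) (Fin n) ℝ) |
      z.1 ∈ Icc (0 : ℝ) 1 ∧ (z.2.1.IsSymm ∧ z.2.2.IsSymm) ∧ p.Admissible c C z.1 z.2},
      ContDiffAt ℝ 1 p.field z := fun z hz => p.contDiffAt_field
    (posDef_of_posSemidef_sub_smul_one hc hz.2.2.1)
    (posDef_of_posSemidef_sub_smul_one hc hz.2.2.2.1)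
  obtain ⟨γ, hγT, hγK, hγ⟩ := exists_limit_terminal_solution (p.isCompact_admissible c C) hF hT
    (a := (p.Qf, p.Qf + p.QfΓ)) tendsto_one_div_atTop_nhds_zero_nat (by
      filter_upwards [h, eventually_ge_atTop 1] with N ⟨γ, ⟨hs, hγT, hγ⟩, hadm⟩ hN
      refine ⟨γ, hγT, fun t ht => ⟨⟨by positivity, ?_⟩, hs t ht, hadm t ht⟩, hγ⟩
      exact div_le_one_of_le₀ (by exact_mod_cast hN) (by positivity))
  exact ⟨γ, ⟨fun t ht => (hγK t ht).2.1, hγT, hγ⟩, fun t ht =>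
    ⟨posDef_of_posSemidef_sub_smul_one hc (hγK t ht).2.2.1,
      posDef_of_posSemidef_sub_smul_one hc (hγK t ht).2.2.2.1⟩⟩

/-- The symmetric part of both components. -/
noncomputable def symPart (x : Matrix (Fin n) (Fin n) ℝ × Matrix (Fin n) (Fin n) ℝ) :
    Matrix (Fin n) (Fin n) ℝ × Matrix (Fin n) (Fin n) ℝ :=
  ((1 / 2 : ℝ) • (x.1 + x.1ᵀ), (1 / 2 : ℝ) • (x.2 + x.2ᵀ))

theorem isSymm_symPart (x : Matrix (Fin n) (Fin n) ℝ × Matrix (Fin n) (Fin n) ℝ) :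
    (symPart x).1.IsSymm ∧ (symPart x).2.IsSymm := by
  simp [IsSymm, symPart, transpose_smul, transpose_add, add_comm]

theorem symPart_eq_self {x : Matrix (Fin n) (Fin n) ℝ × Matrix (Fin n) (Fin n) ℝ}
    (h : x.1.IsSymm ∧ x.2.IsSymm) : symPart x = x := by
  simp only [symPart, h.1.eq, h.2.eq, ← two_smul ℝ, smul_smul]
  norm_num

theorem hasDerivWithinAt_symPart {γ : ℝ → Matrix (Fin n) (Fin n) ℝ × Matrix (Fin n) (Fin n) ℝ}
    {x : Matrix (Fin n) (Fin n) ℝ × Matrix (Fin n) (Fin n) ℝ} {s : Set ℝ} {t : ℝ}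
    (h : HasDerivWithinAt γ x s t) :
    HasDerivWithinAt (fun u => symPart (γ u)) (symPart x) s t := by
  have h₁ := hasDerivWithinAt_matrix.1 h.fst
  have h₂ := hasDerivWithinAt_matrix.1 h.snd
  exact (hasDerivWithinAt_matrix.2 fun i j => ((h₁ i j).add (h₁ j i)).const_mul _).prodMk
    (hasDerivWithinAt_matrix.2 fun i j => ((h₂ i j).add (h₂ j i)).const_mul _)

theorem contDiff_symPart : ContDiff ℝ 1
    (symPart : Matrix (Fin n) (Fin n) ℝ × Matrix (Fin n) (Fin n) ℝ → _) := by
  have ht : ContDiff ℝ 1 fun M : Matrix (Fin n) (Fin n) ℝ => Mᵀ :=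
    contDiff_iff_contDiffAt.2 fun z => contDiffAt_matrix.2 fun i j =>
      contDiffAt_matrix.1 contDiffAt_id j i
  exact ((contDiff_fst.add (ht.comp contDiff_fst)).const_smul _).prodMk
    ((contDiff_snd.add (ht.comp contDiff_snd)).const_smul _)

/-- A solution for `ε = 0` persists for small `ε`, with uniform bounds. -/
theorem Params.exists_eventually_isSolEps (hT : 0 ≤ p.T) (hR : p.R.IsSymm) (hQ : p.Q.IsSymm)
    {γ : ℝ → Matrix (Fin n) (Fin n) ℝ × Matrix (Fin n) (Fin n) ℝ} (hγ : p.IsSolEps 0 γ)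
    (hpos : ∀ t ∈ Icc 0 p.T,
      (p.midDev 0 (γ t).1 (γ t).2).PosDef ∧ (p.midMean 0 (γ t).1 (γ t).2).PosDef) :
    ∃ c : ℝ, 0 < c ∧ ∃ C : ℝ, ∀ᶠ ε in 𝓝 (0 : ℝ), ∃ η, p.IsSolEps ε η ∧
      ∀ t ∈ Icc 0 p.T, p.Admissible c C ε (η t) := by
  obtain ⟨hs, hγT, hγd⟩ := hγ
  have hγc : ContinuousOn γ (Icc 0 p.T) := fun t ht => (hγd t ht).continuousWithinAt
  have hzc : ContinuousOn (fun t => ((0 : ℝ), γ t)) (Icc 0 p.T) := continuousOn_const.prodMk hγc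
  obtain ⟨c₁, hc₁, h₁⟩ := exists_forall_eventually_posSemidef_sub
    (isCompact_Icc.image_of_continuousOn (p.contDiff_midDev.continuous.comp_continuousOn hzc))
    (by rintro _ ⟨t, ht, rfl⟩; exact (hpos t ht).1)
  obtain ⟨c₂, hc₂, h₂⟩ := exists_forall_eventually_posSemidef_sub
    (isCompact_Icc.image_of_continuousOn (p.contDiff_midMean.continuous.comp_continuousOn hzc))
    (by rintro _ ⟨t, ht, rfl⟩; exact (hpos t ht).2)
  obtain ⟨C, hC⟩ := isCompact_Icc.exists_bound_of_continuousOn hγc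
  set σ : ℝ × (Matrix (Fin n) (Fin n) ℝ × Matrix (Fin n) (Fin n) ℝ) →
    ℝ × (Matrix (Fin n) (Fin n) ℝ × Matrix (Fin n) (Fin n) ℝ) :=
      fun z => (z.1, symPart z.2) with hσ
  have hσd : ContDiff ℝ 1 σ := contDiff_fst.prodMk (contDiff_symPart.comp contDiff_snd)
  have hσγ : ∀ t ∈ Icc 0 p.T, σ (0, γ t) = (0, γ t) := fun t ht => by
    simp only [hσ, symPart_eq_self (hs t ht)]
  have hmono : ∀ {M : Matrix (Fin n₁) (Fin n₁) ℝ} {a b : ℝ}, b ≤ a →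
      (M - a • 1).PosSemidef → (M - b • 1).PosSemidef := by
    intro M a b hab h
    have := h.add (PosSemidef.one.smul (sub_nonneg.2 hab))
    convert this using 1
    rw [sub_smul]
    abel
  have hP : ∀ t ∈ Icc 0 p.T, ∀ᶠ z in 𝓝 (0, γ t),
      p.Admissible (min c₁ c₂) (C + 1) (σ z).1 (σ z).2 := by
    intro t ht
    have ht₀ : Tendsto σ (𝓝 (0, γ t)) (𝓝 (0, γ t)) := by
      have := hσd.continuous.tendsto (0, γ t)
      rw [hσγ t ht] at this
      exact this
    have e₁ := ((p.contDiff_midDev.continuous.tendsto (0, γ t)).comp ht₀).eventually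
      (h₁ _ (mem_image_of_mem _ ht))
    have e₂ := ((p.contDiff_midMean.continuous.tendsto (0, γ t)).comp ht₀).eventually
      (h₂ _ (mem_image_of_mem _ ht))
    have e₃ := ((continuous_norm.comp continuous_snd).tendsto ((0 : ℝ), γ t)).comp ht₀ |>.eventually
      (gt_mem_nhds ((hC t ht).trans_lt (lt_add_one C)))
    filter_upwards [e₁, e₂, e₃] with z h₁ h₂ h₃
    have hz := isSymm_symPart z.2
    exact ⟨hmono (min_le_left _ _) (h₁ (p.isSymm_midDev hR _ hz.1 hz.2)),
      hmono (min_le_right _ _) (h₂ (p.isSymm_midMean hR _ hz.1 hz.2)), h₃.le⟩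
  have key := eventually_exists_terminal_solution (F := fun z => p.field (σ z)) hT (γ := γ)
    (fun t ht => by
      refine ContDiffAt.comp (g := p.field) (0, γ t) ?_ hσd.contDiffAt
      rw [hσγ t ht]
      exact p.contDiffAt_field (hpos t ht).1 (hpos t ht).2)
    (fun t ht => by
      rw [hσγ t ht]
      exact hγd t ht) hP
  refine ⟨min c₁ c₂, lt_min hc₁ hc₂, C + 1, ?_⟩
  filter_upwards [key] with ε ⟨η, hηT, hηP, hηd⟩
  refine ⟨fun t => symPart (η t), ⟨fun t _ => isSymm_symPart _, ?_, fun t ht => ?_⟩, hηP⟩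
  · change symPart (η p.T) = _
    rw [hηT, symPart_eq_self (hs _ ⟨hT, le_rfl⟩), hγT]
  · have := hasDerivWithinAt_symPart (hηd t ht)
    rwa [symPart_eq_self (p.isSymm_field hR hQ (isSymm_symPart (η t)).1
      (isSymm_symPart (η t)).2)] at this

end ReducedSystem

section BlockMatrices

open scoped Kronecker

/-- The averaging projection on `ℝ^N`. -/
noncomputable def avg (N : ℕ) : Matrix (Fin N) (Fin N) ℝ := Matrix.of fun _ _ => 1 / (N : ℝ)

theorem avg_mul_avg {N : ℕ} (hN : N ≠ 0) : avg N * avg N = avg N := by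
  ext i j
  simp only [mul_apply, avg, of_apply, Finset.sum_const, Finset.card_univ, Fintype.card_fin,
    nsmul_eq_mul]
  field_simp

theorem transpose_avg (N : ℕ) : (avg N)ᵀ = avg N := rfl

theorem posSemidef_avg {N : ℕ} (hN : N ≠ 0) : (avg N).PosSemidef := by
  have := posSemidef_conjTranspose_mul_self (avg N)
  rwa [conjTranspose_eq_transpose_of_trivial, transpose_avg, avg_mul_avg hN] at this

theorem one_sub_avg_mul_self {N : ℕ} (hN : N ≠ 0) :
    (1 - avg N) * (1 - avg N) = 1 - avg N := by
  simp [sub_mul, mul_sub, avg_mul_avg hN]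

theorem posSemidef_one_sub_avg {N : ℕ} (hN : N ≠ 0) : (1 - avg N).PosSemidef := by
  have := posSemidef_conjTranspose_mul_self (1 - avg N)
  rwa [conjTranspose_eq_transpose_of_trivial, transpose_sub, transpose_one, transpose_avg,
    one_sub_avg_mul_self hN] at this

variable {m k l : Type*} {N : ℕ}

/-- The exchangeable block matrix acting as `X` on deviations from the mean and as `W` on the
mean. -/
noncomputable def blk (N : ℕ) (X W : Matrix m k ℝ) : Matrix (Fin N × m) (Fin N × k) ℝ :=
  (1 - avg N) ⊗ₖ X + avg N ⊗ₖ W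

theorem blk_apply' (X W : Matrix m k ℝ) (x : Fin N × m) (y : Fin N × k) :
    blk N X W x y = (1 - avg N) x.1 y.1 * X x.2 y.2 + avg N x.1 y.1 * W x.2 y.2 := rfl

theorem blk_apply (X W : Matrix m k ℝ) (x : Fin N × m) (y : Fin N × k) :
    blk N X W x y = (if x.1 = y.1 then X x.2 y.2 else 0) + (W x.2 y.2 - X x.2 y.2) / N := by
  rw [blk_apply']
  simp only [Matrix.sub_apply, one_apply, avg, of_apply]
  split_ifs <;> ring

theorem blk_sub (X W X' W' : Matrix m k ℝ) :
    blk N X W - blk N X' W' = blk N (X - X') (W - W') := by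
  ext x y
  simp only [Matrix.sub_apply, blk_apply']
  ring

theorem blk_smul_one [DecidableEq m] (c : ℝ) :
    blk N (c • 1 : Matrix m m ℝ) (c • 1) = c • 1 := by
  ext x y
  simp [blk_apply, one_apply, Prod.ext_iff, ite_and]

theorem transpose_blk (X W : Matrix m k ℝ) : (blk N X W)ᵀ = blk N Xᵀ Wᵀ := by
  ext x y
  simp [blk_apply, eq_comm]

theorem blk_mul [Fintype k] (hN : N ≠ 0) (X W : Matrix m k ℝ) (X' W' : Matrix k l ℝ) :
    blk N X W * blk N X' W' = blk N (X * X') (W * W') := by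
  simp only [blk, Matrix.add_mul, Matrix.mul_add, ← mul_kronecker_mul, one_sub_avg_mul_self hN,
    avg_mul_avg hN]
  simp [sub_mul, mul_sub, avg_mul_avg hN]

theorem inv_blk [Fintype k] [DecidableEq k] (hN : N ≠ 0) {X W : Matrix k k ℝ} (hX : IsUnit X)
    (hW : IsUnit W) : (blk N X W)⁻¹ = blk N X⁻¹ W⁻¹ := by
  refine inv_eq_right_inv ?_
  rw [blk_mul hN, Matrix.mul_nonsing_inv _ ((isUnit_iff_isUnit_det _).1 hX),
    Matrix.mul_nonsing_inv _ ((isUnit_iff_isUnit_det _).1 hW)]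
  simpa using blk_smul_one (N := N) (m := k) 1

theorem posSemidef_blk [Finite k] (hN : N ≠ 0) {X W : Matrix k k ℝ} (hX : X.PosSemidef)
    (hW : W.PosSemidef) : (blk N X W).PosSemidef :=
  ((posSemidef_one_sub_avg hN).kronecker hX).add ((posSemidef_avg hN).kronecker hW)

theorem posSemidef_of_blk [Fintype k] [DecidableEq k] (hN : 2 ≤ N) {X W : Matrix k k ℝ}
    (h : (blk N X W).PosSemidef) : X.PosSemidef ∧ W.PosSemidef := by
  have hN0 : N ≠ 0 := by omega
  have hN1 : (1 : ℝ) < N := by exact_mod_cast hN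
  have hpos : (0 : ℝ) < N := by linarith
  let i : Fin N := ⟨0, by omega⟩
  have h₁ := (h.conjTranspose_mul_mul_same (blk N (1 : Matrix k k ℝ) 0)).submatrix
    (fun a => (i, a))
  have h₂ := (h.conjTranspose_mul_mul_same (blk N (0 : Matrix k k ℝ) 1)).submatrix
    (fun a => (i, a))
  simp only [conjTranspose_eq_transpose_of_trivial, transpose_blk, blk_mul hN0, transpose_one,
    transpose_zero, Matrix.one_mul, Matrix.mul_one, Matrix.zero_mul] at h₁ h₂
  have hc : (0 : ℝ) < 1 - 1 / N := by
    rw [sub_pos, div_lt_one hpos]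
    exact hN1
  constructor
  · convert h₁.smul (inv_nonneg.2 hc.le) using 1
    ext a b
    simp only [Matrix.smul_apply, submatrix_apply, blk_apply, if_true, Matrix.zero_apply,
      smul_eq_mul]
    rw [eq_inv_mul_iff_mul_eq₀ hc.ne']
    ring
  · convert h₂.smul hpos.le using 1
    ext a b
    simp only [Matrix.smul_apply, submatrix_apply, blk_apply, if_true, Matrix.zero_apply,
      smul_eq_mul]
    field_simp
    ring

/-- The deviation part of an exchangeable block matrix, read off from two blocks of a row. -/
def devPart (i j : Fin N) (M : Matrix (Fin N × m) (Fin N × k) ℝ) : Matrix m k ℝ :=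
  Matrix.of fun a b => M (i, a) (i, b) - M (i, a) (j, b)

/-- The mean part of an exchangeable block matrix. -/
def meanPart (i : Fin N) (M : Matrix (Fin N × m) (Fin N × k) ℝ) : Matrix m k ℝ :=
  Matrix.of fun a b => ∑ j, M (i, a) (j, b)

theorem devPart_blk {i j : Fin N} (hij : i ≠ j) (X W : Matrix m k ℝ) :
    devPart i j (blk N X W) = X := by
  ext a b
  simp [devPart, blk_apply, hij]

theorem meanPart_blk (i : Fin N) (X W : Matrix m k ℝ) : meanPart i (blk N X W) = W := by
  have hN : (N : ℝ) ≠ 0 := by exact_mod_cast (Nat.zero_lt_of_lt i.2).ne'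
  ext a b
  simp only [meanPart, of_apply, blk_apply, Finset.sum_add_distrib, Finset.sum_ite_eq,
    Finset.mem_univ, if_true, Finset.sum_const, Finset.card_univ, Fintype.card_fin, nsmul_eq_mul]
  field_simp
  ring

/-- The relabelling of agents by `σ`, acting on block indices. -/
def relabel (m : Type*) (σ : Equiv.Perm (Fin N)) : Fin N × m ≃ Fin N × m :=
  σ.prodCongr (Equiv.refl m)

theorem relabel_apply (σ : Equiv.Perm (Fin N)) (x : Fin N × m) :
    relabel m σ x = (σ x.1, x.2) := rfl

theorem submatrix_blk (σ : Equiv.Perm (Fin N)) (X W : Matrix m k ℝ) :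
    (blk N X W).submatrix (relabel m σ) (relabel k σ) = blk N X W := by
  ext x y
  simp [blk_apply, relabel_apply]

theorem eq_blk_of_forall_submatrix {M : Matrix (Fin N × m) (Fin N × k) ℝ}
    (h : ∀ σ : Equiv.Perm (Fin N), M.submatrix (relabel m σ) (relabel k σ) = M)
    {i j : Fin N} (hij : i ≠ j) : M = blk N (devPart i j M) (meanPart i M) := by
  have hN : (N : ℝ) ≠ 0 := by exact_mod_cast (Nat.zero_lt_of_lt i.2).ne'
  have hσ : ∀ (σ : Equiv.Perm (Fin N)) i' j' a b, M (σ i', a) (σ j', b) = M (i', a) (j', b) :=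
    fun σ i' j' a b => congrFun (congrFun (h σ) (i', a)) (j', b)
  have key : ∀ i' j' a b, M (i', a) (j', b) =
      M (i, a) (j, b) + if i' = j' then devPart i j M a b else 0 := by
    intro i' j' a b
    split_ifs with hij'
    · subst hij'
      rw [← hσ (Equiv.swap i' i) i' i', Equiv.swap_apply_left]
      simp [devPart]
    · obtain ⟨z, hz⟩ : ∃ z, Equiv.swap i i' z = j' := ⟨_, Equiv.swap_apply_self i i' j'⟩
      have hzi : z ≠ i := by
        rintro rfl
        exact hij' (by rw [← hz, Equiv.swap_apply_left])
      have h₁ := hσ (Equiv.swap j z) i j a b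
      have h₂ := hσ (Equiv.swap i i') i z a b
      rw [Equiv.swap_apply_left, Equiv.swap_apply_of_ne_of_ne hij hzi.symm] at h₁
      rw [Equiv.swap_apply_left, hz, h₁] at h₂
      rw [h₂, add_zero]
  have hmean : ∀ a b, meanPart i M a b = N * M (i, a) (j, b) + devPart i j M a b := by
    intro a b
    simp only [meanPart, of_apply]
    rw [Finset.sum_congr rfl fun j' _ => key i j' a b]
    simp [Finset.sum_add_distrib]
  ext ⟨i', a⟩ ⟨j', b⟩
  rw [blk_apply, key, hmean]
  field_simp
  ring

section Norm

variable [Fintype m] [Fintype k]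

theorem sum_abs_le_l1norm (M : Matrix (Fin N × m) (Fin N × k) ℝ) (a : m) (b : k) :
    ∑ i, ∑ j, |M (i, a) (j, b)| ≤ l1norm M := by
  simp only [l1norm, Fintype.sum_prod_type]
  refine Finset.sum_le_sum fun i _ => ?_
  refine le_trans ?_ (Finset.single_le_sum (f := fun a => ∑ j, ∑ b, |M (i, a) (j, b)|)
    (fun a _ => by positivity) (Finset.mem_univ a))
  exact Finset.sum_le_sum fun j _ => Finset.single_le_sum (f := fun b => |M (i, a) (j, b)|)
    (fun b _ => abs_nonneg _) (Finset.mem_univ b)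

theorem abs_le_l1norm_blk_div (hN : 2 ≤ N) (X W : Matrix m k ℝ) (a : m) (b : k) :
    |X a b| ≤ l1norm (blk N X W) / N ∧ |W a b| ≤ l1norm (blk N X W) / N := by
  have hpos : (0 : ℝ) < N := by exact_mod_cast (by omega : 0 < N)
  have : Nontrivial (Fin N) := Fin.nontrivial_iff_two_le.2 hN
  have hrow : ∀ i : Fin N, |X a b| ≤ ∑ j, |blk N X W (i, a) (j, b)| ∧
      |W a b| ≤ ∑ j, |blk N X W (i, a) (j, b)| := by
    intro i
    obtain ⟨j, hj⟩ := exists_ne i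
    constructor
    · have h₁ : X a b = blk N X W (i, a) (i, b) - blk N X W (i, a) (j, b) := by
        simp [blk_apply, hj.symm]
      rw [h₁]
      refine (abs_sub _ _).trans ?_
      rw [← Finset.sum_pair (f := fun j => |blk N X W (i, a) (j, b)|) hj.symm]
      exact Finset.sum_le_sum_of_subset_of_nonneg (Finset.subset_univ _) fun _ _ _ => abs_nonneg _
    · conv_lhs => rw [← meanPart_blk i X W]
      exact Finset.abs_sum_le_sum_abs (fun j => blk N X W (i, a) (j, b)) Finset.univ
  have hle := sum_abs_le_l1norm (blk N X W) a b
  have hconst : ∀ c : ℝ, c * N = ∑ _i : Fin N, c := fun c => by simp [mul_comm]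
  refine ⟨(le_div_iff₀ hpos).2 (le_trans ?_ hle), (le_div_iff₀ hpos).2 (le_trans ?_ hle)⟩ <;>
    rw [hconst]
  · exact Finset.sum_le_sum fun i _ => (hrow i).1
  · exact Finset.sum_le_sum fun i _ => (hrow i).2

theorem l1norm_blk_div_le (hN : N ≠ 0) {X W : Matrix m k ℝ} {C : ℝ} (hX : ∀ a b, |X a b| ≤ C)
    (hW : ∀ a b, |W a b| ≤ C) :
    l1norm (blk N X W) / N ≤ 3 * (Fintype.card m * Fintype.card k) * C := by
  have hpos : (0 : ℝ) < N := by exact_mod_cast Nat.pos_of_ne_zero hN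
  rw [div_le_iff₀ hpos]
  have hentry : ∀ i a j b, |blk N X W (i, a) (j, b)| ≤ (if i = j then C else 0) + 2 * C / N := by
    intro i a j b
    rw [blk_apply]
    refine (abs_add_le _ _).trans (add_le_add ?_ ?_)
    · dsimp only
      split_ifs
      · exact hX _ _
      · simp
    · rw [abs_div, Nat.abs_cast]
      gcongr
      exact (abs_sub _ _).trans (by linarith [hX a b, hW a b])
  simp only [l1norm, Fintype.sum_prod_type]
  refine (Finset.sum_le_sum fun i _ => Finset.sum_le_sum fun a _ => Finset.sum_le_sum fun j _ =>
    Finset.sum_le_sum fun b _ => hentry i a j b).trans_eq ?_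
  simp only [Finset.sum_add_distrib, Finset.sum_const, Finset.card_univ,
    Fintype.card_fin, nsmul_eq_mul, mul_ite, mul_zero, Finset.sum_ite_eq, Finset.mem_univ, if_true]
  field_simp
  ring

end Norm

end BlockMatrices

section LargeSystem

variable {n n₁ : ℕ} (p : Params n n₁) {N : ℕ}

theorem Params.bigA_eq_blk : p.bigA N = blk N p.A (p.A + p.G) := by
  ext x y
  simp [Params.bigA, blk_apply]

theorem Params.bigBhat_eq_blk : p.bigBhat N = blk N p.B p.B := by
  ext x y
  simp [Params.bigBhat, blk_apply]

theorem Params.bigQ_eq_blk : p.bigQ N = blk N p.Q (p.Q + p.QΓ) := by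
  ext x y
  simp [Params.bigQ, blk_apply]

theorem Params.bigQf_eq_blk : p.bigQf N = blk N p.Qf (p.Qf + p.QfΓ) := by
  ext x y
  simp [Params.bigQf, blk_apply]

/-- The control weight of the `N`-agent Riccati equation. -/
noncomputable def Params.weight (N : ℕ) (Z : Matrix (Fin N × Fin n) (Fin N × Fin n) ℝ) :
    Matrix (Fin N × Fin n₁) (Fin N × Fin n₁) ℝ :=
  p.bigR N + (2 : ℝ) • p.M2 N Z

theorem Params.PRic_eq_ric (Z : Matrix (Fin N × Fin n) (Fin N × Fin n) ℝ) :
    p.PRic N Z = ric (p.bigA N) (p.bigBhat N) (p.bigQ N) (p.weight N Z) Z := rfl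

theorem Params.mul_bigE {m : Type*} (M : Matrix m (Fin n₁) ℝ) (i : Fin N) (x : m)
    (y : Fin N × Fin n₁) : (M * p.bigE N i) x y = if y.1 = i then M x y.2 else 0 := by
  by_cases h : y.1 = i <;> simp [mul_apply, Params.bigE, h]

theorem Params.mul_bigIhat {m : Type*} (M : Matrix m (Fin n₁) ℝ) (x : m) (y : Fin N × Fin n₁) :
    (M * p.bigIhat N) x y = M x y.2 := by
  simp [mul_apply, Params.bigIhat]

theorem Params.mul_bigB {m : Type*} (M : Matrix m (Fin N × Fin n) ℝ) (i : Fin N) :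
    M * p.bigB N i = M.submatrix id (fun a => (i, a)) * p.B1 := by
  ext x l
  simp only [mul_apply, Params.bigB, of_apply, Fintype.sum_prod_type, submatrix_apply, id]
  rw [Finset.sum_eq_single i (fun j _ hj => by simp [hj]) (by simp)]
  simp

theorem Params.mul_bigB0 {m : Type*} (M : Matrix m (Fin N × Fin n) ℝ) :
    M * p.bigB0 N = (Matrix.of fun x a => ∑ i, M x (i, a) / N) * p.B0 := by
  ext x l
  simp only [mul_apply, Params.bigB0, of_apply, Fintype.sum_prod_type, Finset.sum_mul]
  rw [Finset.sum_comm]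
  exact Finset.sum_congr rfl fun a _ => Finset.sum_congr rfl fun i _ => by ring

theorem Params.transpose_bigB_mul_mul (Z : Matrix (Fin N × Fin n) (Fin N × Fin n) ℝ) (i : Fin N) :
    (p.bigB N i)ᵀ * Z * p.bigB N i =
      p.B1ᵀ * Z.submatrix (fun a => (i, a)) (fun a => (i, a)) * p.B1 := by
  rw [p.mul_bigB, ← transpose_inj]
  simp only [transpose_mul, transpose_submatrix, transpose_transpose]
  congr 1
  rw [show (Zᵀ * p.bigB N i).submatrix (fun a => (i, a)) id
    = Zᵀ.submatrix (fun a => (i, a)) id * p.bigB N i from rfl, p.mul_bigB]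
  rfl

theorem Params.transpose_bigB0_mul_mul (Z : Matrix (Fin N × Fin n) (Fin N × Fin n) ℝ) :
    (p.bigB0 N)ᵀ * Z * p.bigB0 N =
      p.B0ᵀ * (Matrix.of fun a b => ∑ i, ∑ j, Z (i, a) (j, b) / (N : ℝ) ^ 2) * p.B0 := by
  rw [p.mul_bigB0]
  congr 1
  rw [← transpose_inj, transpose_mul, transpose_transpose]
  have h : (p.bigB0 N)ᵀ * Z = (Zᵀ * p.bigB0 N)ᵀ := by simp
  rw [h, p.mul_bigB0]
  ext b l
  simp only [transpose_apply, mul_apply, of_apply, Finset.sum_div, Finset.sum_mul]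
  rw [Finset.sum_comm]
  refine Finset.sum_congr rfl fun a _ => ?_
  rw [Finset.sum_comm]
  refine Finset.sum_congr rfl fun i _ => Finset.sum_congr rfl fun j _ => ?_
  ring

theorem Params.weight_apply (Z : Matrix (Fin N × Fin n) (Fin N × Fin n) ℝ)
    (x y : Fin N × Fin n₁) :
    p.weight N Z x y = (if x.1 = y.1 then
      p.R1 (Z.submatrix (fun a => (x.1, a)) (fun a => (x.1, a))) x.2 y.2 else 0) +
      (p.B0ᵀ * (Matrix.of fun a b => ∑ i, ∑ j, Z (i, a) (j, b) / (N : ℝ) ^ 2) * p.B0) x.2 y.2 := by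
  have h₁ : ∀ i, ((p.bigE N i)ᵀ * (p.bigB N i)ᵀ * Z * p.bigB N i * p.bigE N i) x y =
      if x.1 = i then if y.1 = i then ((p.bigB N i)ᵀ * Z * p.bigB N i) x.2 y.2 else 0 else 0 := by
    intro i
    have h : (p.bigE N i)ᵀ * (p.bigB N i)ᵀ * Z * p.bigB N i * p.bigE N i =
        (((p.bigB N i)ᵀ * Z * p.bigB N i * p.bigE N i)ᵀ * p.bigE N i)ᵀ := by
      simp only [transpose_mul, transpose_transpose, Matrix.mul_assoc]
    rw [h, transpose_apply, p.mul_bigE, transpose_apply, p.mul_bigE]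
  have h₂ : ((p.bigIhat N)ᵀ * (p.bigB0 N)ᵀ * Z * p.bigB0 N * p.bigIhat N) x y =
      ((p.bigB0 N)ᵀ * Z * p.bigB0 N) x.2 y.2 := by
    have h : (p.bigIhat N)ᵀ * (p.bigB0 N)ᵀ * Z * p.bigB0 N * p.bigIhat N =
        (((p.bigB0 N)ᵀ * Z * p.bigB0 N * p.bigIhat N)ᵀ * p.bigIhat N)ᵀ := by
      simp only [transpose_mul, transpose_transpose, Matrix.mul_assoc]
    rw [h, transpose_apply, p.mul_bigIhat, transpose_apply, p.mul_bigIhat]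
  simp only [Params.weight, Params.M2, Matrix.add_apply, Matrix.smul_apply, Matrix.sum_apply, h₁,
    h₂, Finset.sum_ite_eq, Finset.mem_univ, if_true, smul_eq_mul, ← p.transpose_bigB0_mul_mul,
    Params.R1, ← p.transpose_bigB_mul_mul, Params.bigR, of_apply]
  by_cases hxy : x.1 = y.1
  · simp only [hxy, if_true]
    ring
  · simp only [hxy, Ne.symm hxy, if_false]
    ring

theorem Params.weight_blk (hN : N ≠ 0) (X W : Matrix (Fin n) (Fin n) ℝ) :
    p.weight N (blk N X W) = blk N (p.midDev (1 / N) X W) (p.midMean (1 / N) X W) := by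
  have hN' : (N : ℝ) ≠ 0 := by exact_mod_cast hN
  have hdiag : ∀ i : Fin N, (blk N X W).submatrix (fun a => (i, a)) (fun a => (i, a)) =
      X + (1 / (N : ℝ)) • (W - X) := by
    intro i
    ext a b
    simp only [submatrix_apply, blk_apply, if_true, Matrix.add_apply, Matrix.smul_apply,
      Matrix.sub_apply, smul_eq_mul]
    ring
  have hmean : (Matrix.of fun a b => ∑ i, ∑ j, blk N X W (i, a) (j, b) / (N : ℝ) ^ 2) =
      (1 / (N : ℝ)) • W := by
    ext a b
    have h := fun i : Fin N => congrFun (congrFun (meanPart_blk i X W) a) b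
    simp only [meanPart, of_apply] at h
    simp only [of_apply, ← Finset.sum_div, h, Finset.sum_const, Finset.card_univ, Fintype.card_fin,
      nsmul_eq_mul, Matrix.smul_apply, smul_eq_mul]
    field_simp
  ext x y
  rw [p.weight_apply, hdiag, hmean, blk_apply]
  simp only [Params.midMean, Params.midDev, Matrix.add_apply, Matrix.mul_smul, Matrix.smul_mul,
    Matrix.smul_apply, smul_eq_mul]
  ring

theorem Params.PRic_blk (hN : N ≠ 0) {x : Matrix (Fin n) (Fin n) ℝ × Matrix (Fin n) (Fin n) ℝ}
    (h₁ : (p.midDev (1 / N) x.1 x.2).PosDef) (h₂ : (p.midMean (1 / N) x.1 x.2).PosDef) :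
    p.PRic N (blk N x.1 x.2) =
      blk N (p.field (1 / N, x)).1 (p.field (1 / N, x)).2 := by
  rw [p.PRic_eq_ric, ric, p.weight_blk hN, inv_blk hN h₁.isUnit h₂.isUnit, p.bigA_eq_blk,
    p.bigBhat_eq_blk, p.bigQ_eq_blk]
  simp only [transpose_blk, blk_mul hN, blk_sub]
  rfl

theorem ric_submatrix {m k m' k' : Type*} [Fintype m] [Fintype k] [DecidableEq k] [Fintype m']
    [Fintype k'] [DecidableEq k'] (e : m' ≃ m) (f : k' ≃ k) (A : Matrix m m ℝ) (B : Matrix m k ℝ)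
    (Q : Matrix m m ℝ) (Z : Matrix k k ℝ) (X : Matrix m m ℝ) :
    ric (A.submatrix e e) (B.submatrix e f) (Q.submatrix e e) (Z.submatrix f f) (X.submatrix e e) =
      (ric A B Q Z X).submatrix e e := by
  simp only [ric, inv_submatrix_equiv, transpose_submatrix, submatrix_mul_equiv]
  rfl

theorem Params.weight_submatrix (σ : Equiv.Perm (Fin N))
    (Z : Matrix (Fin N × Fin n) (Fin N × Fin n) ℝ) :
    p.weight N (Z.submatrix (relabel _ σ) (relabel _ σ)) =
      (p.weight N Z).submatrix (relabel _ σ) (relabel _ σ) := by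
  ext x y
  have hmean : (Matrix.of fun a b => ∑ i, ∑ j, Z (σ i, a) (σ j, b) / (N : ℝ) ^ 2) =
      Matrix.of fun a b => ∑ i, ∑ j, Z (i, a) (j, b) / (N : ℝ) ^ 2 := by
    ext a b
    simp only [of_apply]
    rw [← Equiv.sum_comp σ fun i => ∑ j, Z (i, a) (j, b) / (N : ℝ) ^ 2]
    refine Finset.sum_congr rfl fun i _ => ?_
    exact Equiv.sum_comp σ fun j => Z (σ i, a) (j, b) / (N : ℝ) ^ 2
  simp only [submatrix_apply, p.weight_apply, relabel_apply, hmean, σ.injective.eq_iff]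
  rfl

theorem Params.PRic_submatrix (σ : Equiv.Perm (Fin N))
    (Z : Matrix (Fin N × Fin n) (Fin N × Fin n) ℝ) :
    p.PRic N (Z.submatrix (relabel _ σ) (relabel _ σ)) =
      (p.PRic N Z).submatrix (relabel _ σ) (relabel _ σ) := by
  rw [p.PRic_eq_ric, p.PRic_eq_ric, ← ric_submatrix _ (relabel _ σ), p.weight_submatrix,
    p.bigA_eq_blk, p.bigBhat_eq_blk, p.bigQ_eq_blk, submatrix_blk, submatrix_blk, submatrix_blk]

end LargeSystem

section Equivalence

open Topology Filter

attribute [local instance] Matrix.normedAddCommGroup Matrix.normedSpace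

variable {n n₁ : ℕ} (p : Params n n₁) {N : ℕ}

theorem hasDerivWithinAt_blk {m k : Type*} [Fintype m] [Fintype k]
    {γ : ℝ → Matrix m k ℝ × Matrix m k ℝ} {x : Matrix m k ℝ × Matrix m k ℝ} {s : Set ℝ} {t : ℝ}
    (h : HasDerivWithinAt γ x s t) (i : Fin N × m) (j : Fin N × k) :
    HasDerivWithinAt (fun u => blk N (γ u).1 (γ u).2 i j) (blk N x.1 x.2 i j) s t :=
  ((hasDerivWithinAt_matrix.1 h.fst _ _).const_mul _).add
    ((hasDerivWithinAt_matrix.1 h.snd _ _).const_mul _)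

theorem hasDerivWithinAt_parts {m k : Type*} [Fintype m] [Fintype k]
    {P : ℝ → Matrix (Fin N × m) (Fin N × k) ℝ} {P' : Matrix (Fin N × m) (Fin N × k) ℝ}
    {s : Set ℝ} {t : ℝ} (h : ∀ x y, HasDerivWithinAt (fun u => P u x y) (P' x y) s t)
    (i j : Fin N) :
    HasDerivWithinAt (fun u => (devPart i j (P u), meanPart i (P u)))
      (devPart i j P', meanPart i P') s t :=
  (hasDerivWithinAt_matrix.2 fun _ _ => (h _ _).sub (h _ _)).prodMk
    (hasDerivWithinAt_matrix.2 fun a b => by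
      simp only [meanPart, of_apply]
      exact HasDerivWithinAt.fun_sum fun j _ => h (i, a) (j, b))

/-- Reduced solutions induce solutions of the `N`-agent Riccati equation. -/
theorem Params.isSolP_blk (hN : N ≠ 0) {c C : ℝ} (hc : 0 < c)
    {γ : ℝ → Matrix (Fin n) (Fin n) ℝ × Matrix (Fin n) (Fin n) ℝ}
    (hγ : p.IsSolEps (1 / N) γ) (hadm : ∀ t ∈ Icc 0 p.T, p.Admissible c C (1 / N) (γ t)) :
    p.IsSolP N (fun t => blk N (γ t).1 (γ t).2) ∧
      (∀ t ∈ Icc 0 p.T, l1norm (blk N (γ t).1 (γ t).2) / N ≤ 3 * (n * n) * C) ∧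
      ∀ t ∈ Icc 0 p.T, (p.weight N (blk N (γ t).1 (γ t).2) - c • 1).PosSemidef := by
  obtain ⟨hs, hγT, hγd⟩ := hγ
  have hpsd : ∀ t ∈ Icc 0 p.T, (p.weight N (blk N (γ t).1 (γ t).2) - c • 1).PosSemidef := by
    intro t ht
    rw [p.weight_blk hN, ← blk_smul_one, blk_sub]
    exact posSemidef_blk hN (hadm t ht).1 (hadm t ht).2.1
  refine ⟨⟨fun t ht => ?_, fun t ht => posDef_of_posSemidef_sub_smul_one hc (hpsd t ht), ?_,
    fun t ht x y => ?_⟩, fun t ht => ?_, hpsd⟩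
  · rw [IsSymm, transpose_blk, (hs t ht).1.eq, (hs t ht).2.eq]
  · change blk N (γ p.T).1 (γ p.T).2 = _
    rw [hγT, p.bigQf_eq_blk]
  · rw [p.PRic_blk hN (posDef_of_posSemidef_sub_smul_one hc (hadm t ht).1)
      (posDef_of_posSemidef_sub_smul_one hc (hadm t ht).2.1)]
    exact hasDerivWithinAt_blk (hγd t ht) x y
  · have h := (hadm t ht).2.2
    have h₁ := (norm_fst_le (γ t)).trans h
    have h₂ := (norm_snd_le (γ t)).trans h
    have e₁ : ∀ a b, |(γ t).1 a b| ≤ C := fun a b =>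
      (Matrix.norm_entry_le_entrywise_sup_norm (γ t).1).trans h₁
    have e₂ : ∀ a b, |(γ t).2 a b| ≤ C := fun a b =>
      (Matrix.norm_entry_le_entrywise_sup_norm (γ t).2).trans h₂
    simpa using l1norm_blk_div_le hN e₁ e₂

theorem Params.contDiff_weight : ContDiff ℝ 1 (p.weight N) := by
  refine contDiff_iff_contDiffAt.2 fun z => ?_
  refine contDiffAt_const.add (ContDiffAt.const_smul _
    ((ContDiffAt.const_smul _ (ContDiffAt.sum fun i _ => ?_)).add (ContDiffAt.const_smul _ ?_)))
  · exact contDiffAt_matrix_mul (contDiffAt_matrix_mul (contDiffAt_matrix_mul contDiffAt_const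
      contDiffAt_id) contDiffAt_const) contDiffAt_const
  · exact contDiffAt_matrix_mul (contDiffAt_matrix_mul (contDiffAt_matrix_mul contDiffAt_const
      contDiffAt_id) contDiffAt_const) contDiffAt_const

theorem Params.submatrix_eq_of_isSolP {c C : ℝ} (hc : 0 < c)
    {P : ℝ → Matrix (Fin N × Fin n) (Fin N × Fin n) ℝ} (hP : p.IsSolP N P)
    (hbd : ∀ t ∈ Icc 0 p.T, ∀ x y, |P t x y| ≤ C)
    (hpsd : ∀ t ∈ Icc 0 p.T, (p.weight N (P t) - c • 1).PosSemidef)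
    (σ : Equiv.Perm (Fin N)) {t : ℝ} (ht : t ∈ Icc 0 p.T) :
    (P t).submatrix (relabel _ σ) (relabel _ σ) = P t := by
  obtain ⟨-, -, hPT, hPd⟩ := hP
  have hsub : Continuous fun M : Matrix (Fin N × Fin n₁) (Fin N × Fin n₁) ℝ => M - c • 1 := by
    fun_prop
  have hK : IsCompact {M : Matrix (Fin N × Fin n) (Fin N × Fin n) ℝ |
      ‖M‖ ≤ max C 0 ∧ (p.weight N M - c • 1).PosSemidef} := by
    refine (isCompact_closedBall 0 (max C 0)).of_isClosed_subset
      ((isClosed_le continuous_norm continuous_const).inter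
        (isClosed_setOf_posSemidef.preimage (hsub.comp p.contDiff_weight.continuous)))
      fun M hM => mem_closedBall_zero_iff.2 hM.1
  refine eq_of_terminal_solutions (f := p.PRic N)
    (γ := fun t => (P t).submatrix (relabel _ σ) (relabel _ σ)) (η := P) hK (fun M hM => ?_)
    (fun t ht => ?_) (fun t ht => ?_) (fun t ht => ⟨?_, ?_⟩) (fun t ht => ⟨?_, hpsd t ht⟩) ?_ ht
  · exact contDiffAt_ric _ _ _ p.contDiff_weight.contDiffAt contDiffAt_id
      (posDef_of_posSemidef_sub_smul_one hc hM.2).isUnit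
  · rw [p.PRic_submatrix]
    exact hasDerivWithinAt_matrix.2 fun x y => hPd t ht _ _
  · exact hasDerivWithinAt_matrix.2 (hPd t ht)
  · exact norm_le_of_forall_abs_le (le_max_right _ _) fun x y =>
      (hbd t ht _ _).trans (le_max_left _ _)
  · rw [p.weight_submatrix]
    convert (hpsd t ht).submatrix (relabel _ σ) using 1
    ext x y
    simp [one_apply]
  · exact norm_le_of_forall_abs_le (le_max_right _ _) fun x y =>
      (hbd t ht _ _).trans (le_max_left _ _)
  · rw [hPT, p.bigQf_eq_blk, submatrix_blk]

theorem abs_le_l1norm {m k : Type*} [Fintype m] [Fintype k] (M : Matrix m k ℝ) (i : m) (j : k) :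
    |M i j| ≤ l1norm M :=
  (Finset.single_le_sum (f := fun j => |M i j|) (fun _ _ => abs_nonneg _)
    (Finset.mem_univ j)).trans (Finset.single_le_sum (f := fun i => ∑ j, |M i j|)
      (fun _ _ => Finset.sum_nonneg fun _ _ => abs_nonneg _) (Finset.mem_univ i))

/-- Solutions of the `N`-agent Riccati equation reduce to deviation and mean parts. -/
theorem Params.exists_isSolEps_of_isSolP (hT : 0 ≤ p.T) (hN : 2 ≤ N) {c C : ℝ} (hc : 0 < c)
    {P : ℝ → Matrix (Fin N × Fin n) (Fin N × Fin n) ℝ} (hP : p.IsSolP N P)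
    (hbd : ∀ t ∈ Icc 0 p.T, l1norm (P t) / N ≤ C)
    (hpsd : ∀ t ∈ Icc 0 p.T, (p.weight N (P t) - c • 1).PosSemidef) :
    ∃ γ, p.IsSolEps (1 / N) γ ∧ ∀ t ∈ Icc 0 p.T, p.Admissible c C (1 / N) (γ t) := by
  have hN0 : N ≠ 0 := by omega
  have hpos : (0 : ℝ) < N := by exact_mod_cast (by omega : 0 < N)
  have hij : (⟨0, by omega⟩ : Fin N) ≠ ⟨1, by omega⟩ := by simp
  set i : Fin N := ⟨0, by omega⟩
  set j : Fin N := ⟨1, by omega⟩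
  have hblk : ∀ t ∈ Icc 0 p.T, P t = blk N (devPart i j (P t)) (meanPart i (P t)) := fun t ht =>
    eq_blk_of_forall_submatrix (fun σ => p.submatrix_eq_of_isSolP hc hP (C := C * N)
      (fun t ht x y => (abs_le_l1norm _ x y).trans ((div_le_iff₀ hpos).1 (hbd t ht))) hpsd σ ht) hij
  have hC : 0 ≤ C := le_trans (by unfold l1norm; positivity) (hbd 0 ⟨le_rfl, hT⟩)
  have hadm : ∀ t ∈ Icc 0 p.T, p.Admissible c C (1 / N) (devPart i j (P t), meanPart i (P t)) := by
    intro t ht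
    have h₁ := hpsd t ht
    rw [hblk t ht, p.weight_blk hN0, ← blk_smul_one, blk_sub] at h₁
    have h₂ := posSemidef_of_blk hN h₁
    have h₃ := hbd t ht
    rw [hblk t ht] at h₃
    refine ⟨h₂.1, h₂.2, max_le ?_ ?_⟩
    · exact norm_le_of_forall_abs_le hC fun a b => (abs_le_l1norm_blk_div hN _ _ a b).1.trans h₃
    · exact norm_le_of_forall_abs_le hC fun a b => (abs_le_l1norm_blk_div hN _ _ a b).2.trans h₃
  obtain ⟨hs, -, hPT, hPd⟩ := hP
  refine ⟨fun t => (devPart i j (P t), meanPart i (P t)), ⟨fun t ht => ?_, ?_, fun t ht => ?_⟩,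
    hadm⟩
  · have h := (hs t ht).eq
    rw [hblk t ht, transpose_blk] at h
    have h₁ := congrArg (devPart i j) h
    have h₂ := congrArg (meanPart i) h
    rw [devPart_blk hij, devPart_blk hij] at h₁
    rw [meanPart_blk, meanPart_blk] at h₂
    exact ⟨h₁, h₂⟩
  · change (devPart i j (P p.T), meanPart i (P p.T)) = _
    rw [hPT, p.bigQf_eq_blk, devPart_blk hij, meanPart_blk]
  · have h := hasDerivWithinAt_parts (hPd t ht) i j
    have hric := p.PRic_blk hN0 (posDef_of_posSemidef_sub_smul_one hc (hadm t ht).1)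
      (posDef_of_posSemidef_sub_smul_one hc (hadm t ht).2.1)
    rw [← hblk t ht] at hric
    rw [hric, devPart_blk hij, meanPart_blk] at h
    exact h

/-- The limiting system is the reduced system at `ε = 0`. -/
theorem Params.exists_isSolLim_iff :
    (∃ Λ₁ Λ₂ : ℝ → Matrix (Fin n) (Fin n) ℝ, p.IsSolLim Λ₁ Λ₂) ↔
      ∃ γ, p.IsSolEps 0 γ ∧ ∀ t ∈ Icc 0 p.T,
        (p.midDev 0 (γ t).1 (γ t).2).PosDef ∧ (p.midMean 0 (γ t).1 (γ t).2).PosDef := by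
  have hdev : ∀ X W, p.midDev 0 X W = p.R1 X := by simp [Params.midDev]
  have hmean : ∀ X Y, p.midMean 0 X (X + Y) = p.R2 X Y := by
    simp [Params.midMean, hdev, Params.R1, Params.R2]
  have hΨ : ∀ X Y, p.field (0, (X, X + Y)) = (p.Ψ₁ X, p.Ψ₁ X + p.Ψ₂ X Y) := by
    intro X Y
    simp only [Params.field, hdev, hmean, ric, Params.Ψ₁, Params.Ψ₂, transpose_add,
      Matrix.mul_add, Matrix.add_mul, Prod.mk.injEq, true_and]
    abel
  constructor
  · rintro ⟨Λ₁, Λ₂, hs, hpd, h₁T, h₂T, h₁, h₂⟩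
    refine ⟨fun t => (Λ₁ t, Λ₁ t + Λ₂ t), ⟨fun t ht => ⟨(hs t ht).1, (hs t ht).1.add (hs t ht).2⟩,
      by simp only [h₁T, h₂T], fun t ht => ?_⟩, fun t ht => ?_⟩
    · rw [hΨ]
      have h₁' := hasDerivWithinAt_matrix.2 (h₁ t ht)
      have h₂' := hasDerivWithinAt_matrix.2 (h₂ t ht)
      exact h₁'.prodMk (h₁'.add h₂')
    · simp only [hdev, hmean]
      exact hpd t ht
  · rintro ⟨γ, ⟨hs, hγT, hγd⟩, hpd⟩
    have hγ : ∀ t, γ t = ((γ t).1, (γ t).1 + ((γ t).2 - (γ t).1)) := fun t => by simp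
    have hΨγ : ∀ t, p.field (0, γ t) =
        (p.Ψ₁ (γ t).1, p.Ψ₁ (γ t).1 + p.Ψ₂ (γ t).1 ((γ t).2 - (γ t).1)) := fun t => by
      conv_lhs => rw [hγ t]
      exact hΨ _ _
    refine ⟨fun t => (γ t).1, fun t => (γ t).2 - (γ t).1,
      fun t ht => ⟨(hs t ht).1, (hs t ht).2.sub (hs t ht).1⟩, fun t ht => ?_, ?_, ?_,
      fun t ht i j => ?_, fun t ht i j => ?_⟩
    · rw [← hdev _ (γ t).2, ← hmean, add_sub_cancel]
      exact hpd t ht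
    · simp only [hγT]
    · simp only [hγT, add_sub_cancel_left]
    · have h := hγd t ht
      rw [hΨγ] at h
      exact hasDerivWithinAt_matrix.1 h.fst i j
    · have h := hγd t ht
      rw [hΨγ] at h
      have h₁ := hasDerivWithinAt_matrix.1 h.fst i j
      have h₂ := hasDerivWithinAt_matrix.1 h.snd i j
      have h' := h₂.sub h₁
      simp only [Matrix.add_apply, add_sub_cancel_left] at h'
      exact h'

end Equivalence

/-- The LQ mean field social optimization problem has asymptotic solvability
if and only if the limiting ODE system (ODE-Λ) has a solution (Λ₁, Λ₂) on [0, T]. -/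
theorem asymptotic_solvability_iff_limit_system {n n₁ : ℕ} (p : Params n n₁)
    (hp : p.Standing) :
    p.AsympSolvable ↔
      ∃ Λ₁ Λ₂ : ℝ → Matrix (Fin n) (Fin n) ℝ, p.IsSolLim Λ₁ Λ₂ := by
  obtain ⟨-, -, hT, hQ, -, hR⟩ := hp
  rw [p.exists_isSolLim_iff]
  constructor
  · rintro ⟨N₀, -, c, hc, C, h⟩
    refine p.exists_isSolEps_zero hT.le hc (C := C) ?_
    filter_upwards [Filter.eventually_ge_atTop N₀, Filter.eventually_ge_atTop 2] with N hN₀ hN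
    obtain ⟨P, hP, hbd, hpsd⟩ := h N hN₀
    exact p.exists_isSolEps_of_isSolP hT.le hN hc hP hbd hpsd
  · rintro ⟨γ, hγ, hpd⟩
    obtain ⟨c, hc, C, h⟩ := p.exists_eventually_isSolEps hT.le hR hQ hγ hpd
    obtain ⟨N₀, hN₀⟩ := Filter.eventually_atTop.1
      (tendsto_one_div_atTop_nhds_zero_nat (𝕜 := ℝ) |>.eventually h)
    refine ⟨max N₀ 1, le_max_right _ _, c, hc, 3 * (n * n) * C, fun N hN => ?_⟩
    obtain ⟨η, hη, hadm⟩ := hN₀ N ((le_max_left _ _).trans hN)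
    have hN1 : 1 ≤ N := (le_max_right _ _).trans hN
    exact ⟨_, p.isSolP_blk (by omega) hc hη hadm⟩

end LQ
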